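/- arXiv:2010.05643 — 5 statements merged into one kernel-verified Lean document; each statement's English description precedes it below -/
import Mathlib

section
/- Let r ≥ 1 be an integer and let T be a tournament with dichromatic number χ(T) ≥ 2r. Then T contains a strong K⃗_r minor, i.e. sm(T) ≥ r. -/
/-- A digraph on `V` is given by its adjacency relation `Adj` (loopless when
`Irreflexive Adj`).  `StronglyConnectedOn Adj S` says that the subdigraph of
the digraph induced by the vertex set `S` is strongly connected: for every
ordered pair of vertices of `S` there is a directed path inside `S` between
them. -/
def StronglyConnectedOn {V : Type} (Adj : V → V → Prop) (S : Set V) : Prop :=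
  ∀ ⦃u⦄, u ∈ S → ∀ ⦃v⦄, v ∈ S →
    Relation.ReflTransGen (fun a b => a ∈ S ∧ b ∈ S ∧ Adj a b) u v

/-- `S` is acyclic: the subdigraph induced by `S` contains no directed cycle. -/
def AcyclicOn {V : Type} (Adj : V → V → Prop) (S : Set V) : Prop :=
  ∀ v ∈ S, ¬ Relation.TransGen (fun a b => a ∈ S ∧ b ∈ S ∧ Adj a b) v v

/-- The subdigraph induced by `S` admits a partition of its vertex set into
`k` acyclic sets (a `k`-colouring). -/
def DiColorableOn {V : Type} (Adj : V → V → Prop) (S : Set V) (k : ℕ) : Prop :=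
  ∃ c : V → ℕ, (∀ v ∈ S, c v < k) ∧ ∀ i : ℕ, AcyclicOn Adj {v ∈ S | c v = i}

/-- The dichromatic number of the subdigraph induced by `S`: the least `k`
for which a `k`-colouring exists.  The dichromatic number of the whole
digraph is `dichromaticNumberOn Adj Set.univ`. -/
noncomputable def dichromaticNumberOn {V : Type} (Adj : V → V → Prop) (S : Set V) : ℕ :=
  sInf {k | DiColorableOn Adj S k}

/-- A tournament: a loopless digraph with exactly one directed edge between
any two distinct vertices. -/
def IsTournament {V : Type} (Adj : V → V → Prop) : Prop :=
  Irreflexive Adj ∧ ∀ u v : V, u ≠ v → (Adj u v ↔ ¬ Adj v u)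

/-- The digraph contains a strong `K⃗ r` minor: there are `r` pairwise
disjoint nonempty branch sets, each inducing a strongly connected
subdigraph, with at least one edge in each direction between any two
distinct branch sets. -/
def ContainsStrongCompleteMinor {V : Type} (Adj : V → V → Prop) (r : ℕ) : Prop :=
  ∃ X : Fin r → Set V,
    (∀ i, (X i).Nonempty) ∧
    (∀ i j, i ≠ j → Disjoint (X i) (X j)) ∧
    (∀ i, StronglyConnectedOn Adj (X i)) ∧
    (∀ i j, i ≠ j → ∃ u ∈ X i, ∃ v ∈ X j, Adj u v)

/-- Out-degree of a vertex. -/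
noncomputable def outDeg {V : Type} (Adj : V → V → Prop) (v : V) : ℕ :=
  {w | Adj v w}.ncard

/-- In-degree of a vertex. -/
noncomputable def inDeg {V : Type} (Adj : V → V → Prop) (v : V) : ℕ :=
  {w | Adj w v}.ncard

/-- The subdigraph induced by `W` is `k`-strongly-connected: it has at least
`k + 1` vertices and remains strongly connected after deleting any set of at
most `k - 1` vertices. -/
def KStronglyConnectedOn {V : Type} (Adj : V → V → Prop) (W : Set V) (k : ℕ) : Prop :=
  k + 1 ≤ W.ncard ∧
  ∀ S : Set V, S ⊆ W → S.ncard ≤ k - 1 → StronglyConnectedOn Adj (W \ S)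

/-- Transitivity of the adjacency relation on a set (for tournaments: acyclicity). -/
def TrOn {V : Type} (Adj : V → V → Prop) (S : Set V) : Prop :=
  ∀ a ∈ S, ∀ b ∈ S, ∀ c ∈ S, Adj a b → Adj b c → Adj a c

/-- Working form of the tournament axioms. -/
structure Tour {V : Type} (Adj : V → V → Prop) : Prop where
  asym : ∀ u v, Adj u v → ¬ Adj v u
  total : ∀ u v, u ≠ v → Adj u v ∨ Adj v u

theorem Tour.of {V : Type} {Adj : V → V → Prop} (h : IsTournament Adj) : Tour Adj := by
  refine ⟨fun u v huv hvu => ?_, fun u v huv => ?_⟩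
  · by_cases e : u = v
    · subst e; exact h.1 u huv
    · exact (h.2 u v e).1 huv hvu
  · by_cases hvu : Adj v u
    · exact Or.inr hvu
    · exact Or.inl ((h.2 u v huv).2 hvu)

theorem Tour.flip {V : Type} {Adj : V → V → Prop} (h : Tour Adj) :
    Tour (fun a b => Adj b a) :=
  ⟨fun u v a b => h.asym u v b a, fun u v e => (h.total u v e).symm⟩

theorem Tour.irr {V : Type} {Adj : V → V → Prop} (h : Tour Adj) (v : V) : ¬ Adj v v :=
  fun a => h.asym v v a a

theorem TrOn.acyclic {V : Type} {Adj : V → V → Prop} (h : Tour Adj) {S : Set V}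
    (hS : TrOn Adj S) : AcyclicOn Adj S := by
  intro v hv hc
  have key : ∀ w, Relation.TransGen (fun a b => a ∈ S ∧ b ∈ S ∧ Adj a b) v w →
      w ∈ S ∧ Adj v w := by
    intro w hw
    induction hw with
    | single h => exact ⟨h.2.1, h.2.2⟩
    | tail _ h2 ih => exact ⟨h2.2.1, hS _ hv _ ih.1 _ h2.2.1 ih.2 h2.2.2⟩
  exact h.irr v (key v hc).2

theorem TrOn.mono {V : Type} {Adj : V → V → Prop} {S T : Set V}
    (hS : TrOn Adj S) (hTS : T ⊆ S) : TrOn Adj T :=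
  fun a ha b hb c hc => hS a (hTS ha) b (hTS hb) c (hTS hc)

theorem TrOn.union {V : Type} {Adj : V → V → Prop} (h : Tour Adj) {P Q : Set V}
    (hP : TrOn Adj P) (hQ : TrOn Adj Q) (hPQ : ∀ p ∈ P, ∀ q ∈ Q, Adj p q) :
    TrOn Adj (P ∪ Q) := by
  intro a ha b hb c hc hab hbc
  rcases ha with ha | ha <;> rcases hb with hb | hb <;> rcases hc with hc | hc
  · exact hP a ha b hb c hc hab hbc
  · exact hPQ _ ha _ hc
  · exact absurd hbc (h.asym _ _ (hPQ _ hc _ hb))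
  · exact hPQ _ ha _ hc
  · exact absurd hab (h.asym _ _ (hPQ _ hb _ ha))
  · exact absurd hab (h.asym _ _ (hPQ _ hb _ ha))
  · exact absurd hbc (h.asym _ _ (hPQ _ hc _ hb))
  · exact hQ a ha b hb c hc hab hbc

theorem TrOn.single {V : Type} {Adj : V → V → Prop} (_h : Tour Adj) (x : V) :
    TrOn Adj {x} := by
  rintro a rfl b rfl c rfl hab _
  exact hab

theorem TrOn.pair {V : Type} {Adj : V → V → Prop} (h : Tour Adj) (x y : V) :
    TrOn Adj {x, y} := by
  have h1 := h.irr
  have h2 := h.asym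
  rintro a (rfl | rfl) b (rfl | rfl) c (rfl | rfl) hab hbc <;> grind

theorem exists_source {V : Type} [Finite V] {Adj : V → V → Prop} (h : Tour Adj) {S : Set V}
    (hS : TrOn Adj S) (hne : S.Nonempty) : ∃ s ∈ S, ∀ x ∈ S, x ≠ s → Adj s x := by
  have hfin : S.Finite := S.toFinite
  induction S, hfin using Set.Finite.induction_on with
  | empty => exact absurd hne (by simp)
  | @insert a S _ _ ih =>
    by_cases hn : S.Nonempty
    · obtain ⟨s, hs, hs'⟩ := ih (hS.mono (Set.subset_insert _ _)) hn
      by_cases has : a = s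
      · subst has
        exact ⟨a, Set.mem_insert _ _, by rintro x (rfl | hx) hxa <;> [exact absurd rfl hxa; exact hs' x hx hxa]⟩
      · rcases h.total a s has with h1 | h1
        · refine ⟨a, Set.mem_insert _ _, ?_⟩
          rintro x (rfl | hx) hxa
          · exact absurd rfl hxa
          · by_cases hxs : x = s
            · subst hxs; exact h1
            · exact hS a (Set.mem_insert _ _) s (Set.mem_insert_of_mem _ hs) x
                (Set.mem_insert_of_mem _ hx) h1 (hs' x hx hxs)
        · refine ⟨s, Set.mem_insert_of_mem _ hs, ?_⟩
          rintro x (rfl | hx) hxa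
          · exact h1
          · exact hs' x hx hxa
    · rw [Set.not_nonempty_iff_eq_empty] at hn
      subst hn
      exact ⟨a, Set.mem_insert _ _, by rintro x (rfl | hx) hxa <;> [exact absurd rfl hxa; exact absurd hx (by simp)]⟩

theorem exists_sink {V : Type} [Finite V] {Adj : V → V → Prop} (h : Tour Adj) {S : Set V}
    (hS : TrOn Adj S) (hne : S.Nonempty) : ∃ s ∈ S, ∀ x ∈ S, x ≠ s → Adj x s :=
  exists_source (Adj := fun a b => Adj b a) h.flip
    (fun a ha b hb c hc hab hbc => hS c hc b hb a ha hbc hab) hne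

theorem exists_max {V : Type} [Finite V] {Adj : V → V → Prop} (h : Tour Adj) {I D : Set V}
    (hI : TrOn Adj I) (hID : I ⊆ D) : ∃ B, I ⊆ B ∧ B ⊆ D ∧ TrOn Adj B ∧
      ∀ v ∈ D, v ∉ B → (∃ x ∈ B, Adj v x) ∧ (∃ x ∈ B, Adj x v) := by
  have hf : {B : Set V | I ⊆ B ∧ B ⊆ D ∧ TrOn Adj B}.Finite := Set.toFinite _
  obtain ⟨B, hB⟩ := hf.exists_maximal ⟨I, subset_rfl, hID, hI⟩
  obtain ⟨⟨h1, h2, h3⟩, hmax⟩ := hB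
  refine ⟨B, h1, h2, h3, fun v hvD hvB => ?_⟩
  have no : ¬ TrOn Adj (B ∪ {v}) := by
    intro ht
    have : B ∪ {v} ⊆ B := hmax ⟨h1.trans Set.subset_union_left,
      Set.union_subset h2 (by simpa using hvD), ht⟩ Set.subset_union_left
    exact hvB (this (Or.inr rfl))
  constructor
  · by_contra hc
    push Not at hc
    apply no
    refine TrOn.union h h3 (TrOn.single h v) ?_
    rintro p hp q rfl
    rcases h.total p q (fun e => hvB (e ▸ hp)) with h' | h'
    · exact h'
    · exact absurd h' (hc p hp)
  · by_contra hc
    push Not at hc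
    apply no
    rw [Set.union_comm]
    refine TrOn.union h (TrOn.single h v) h3 ?_
    rintro q rfl p hp
    rcases h.total p q (fun e => hvB (e ▸ hp)) with h' | h'
    · exact absurd h' (hc p hp)
    · exact h'

/-- There is a walk of length `n` from `v` to `s`. -/
def WalkTo {V : Type} (Adj : V → V → Prop) (s : V) : ℕ → V → Prop
  | 0, v => v = s
  | n + 1, v => ∃ w, Adj v w ∧ WalkTo Adj s n w

theorem exists_dist {V : Type} {Adj : V → V → Prop} (s : V)
    (hs : ∀ v, Relation.ReflTransGen Adj v s) :
    ∃ d : V → ℕ, (∀ v, d v = 0 ↔ v = s) ∧ (∀ v w, Adj v w → d v ≤ d w + 1) ∧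
      (∀ v n, d v = n + 1 → ∃ w, Adj v w ∧ d w = n) := by
  classical
  have hex : ∀ v, ∃ n, WalkTo Adj s n v := by
    intro v
    induction hs v using Relation.ReflTransGen.head_induction_on with
    | refl => exact ⟨0, rfl⟩
    | head h1 _ ih => obtain ⟨n, hn⟩ := ih; exact ⟨n + 1, _, h1, hn⟩
  have hle : ∀ v w, Adj v w → Nat.find (hex v) ≤ Nat.find (hex w) + 1 := by
    intro v w hvw
    exact Nat.find_min' _ ⟨w, hvw, Nat.find_spec (hex w)⟩
  refine ⟨fun v => Nat.find (hex v), fun v => ?_, hle, fun v n hn => ?_⟩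
  · rw [Nat.find_eq_zero]; rfl
  · have h1 := Nat.find_spec (hex v)
    have hn' : Nat.find (hex v) = n + 1 := hn
    rw [hn'] at h1
    obtain ⟨w, hvw, hw⟩ := h1
    have h2 : Nat.find (hex w) ≤ n := Nat.find_min' _ hw
    have h3 := hle v w hvw
    exact ⟨w, hvw, by show Nat.find (hex w) = n; omega⟩

/-- A root `s`, the distance function to `s`, and a transitive set at distance two
which in-dominates the vertices at distance one. -/
structure Setup {V : Type} (Adj : V → V → Prop) (s : V) (d : V → ℕ) (A : Set V) : Prop where
  tour : Tour Adj
  d0 : ∀ v, d v = 0 ↔ v = s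
  dle : ∀ v w, Adj v w → d v ≤ d w + 1
  dsucc : ∀ v n, d v = n + 1 → ∃ w, Adj v w ∧ d w = n
  Ad : ∀ x ∈ A, d x = 2
  Atr : TrOn Adj A
  Adom : ∀ w, d w = 1 → ∃ x ∈ A, Adj x w

/-- `x` reaches `s` inside `X`. -/
def Rch {V : Type} (Adj : V → V → Prop) (s : V) (X : Set V) (x : V) : Prop :=
  Relation.ReflTransGen (fun a b => a ∈ X ∧ b ∈ X ∧ Adj a b) x s

theorem Rch.mono {V : Type} {Adj : V → V → Prop} {s : V} {X Y : Set V} {x : V}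
    (h : Rch Adj s X x) (hXY : X ⊆ Y) : Rch Adj s Y x :=
  Relation.ReflTransGen.lift id (fun _ _ h => ⟨hXY h.1, hXY h.2.1, h.2.2⟩) _ _ h

theorem Rch.step {V : Type} {Adj : V → V → Prop} {s : V} {X : Set V} {x y : V}
    (h : Rch Adj s X y) (hx : x ∈ X) (hy : y ∈ X) (hxy : Adj x y) : Rch Adj s X x :=
  Relation.ReflTransGen.head ⟨hx, hy, hxy⟩ h

theorem Rch.root {V : Type} {Adj : V → V → Prop} {s : V} {X : Set V} : Rch Adj s X s :=
  Relation.ReflTransGen.refl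

theorem Rch.sink {V : Type} {Adj : V → V → Prop} {s : V} {X B : Set V} {t : V}
    (h : Rch Adj s X t) (hB : B ⊆ X) (ht : t ∈ B) (hs : ∀ x ∈ B, x ≠ t → Adj x t) :
    ∀ x ∈ B, Rch Adj s X x := by
  intro x hx
  by_cases e : x = t
  · subst e; exact h
  · exact h.step (hB hx) (hB ht) (hs x hx e)

namespace Setup
variable {V : Type} {Adj : V → V → Prop} {s : V} {d : V → ℕ} {A : Set V}

theorem far (S : Setup Adj s d A) {v w : V} (h : d v + 2 ≤ d w) : Adj v w := by
  rcases S.tour.total v w (by rintro rfl; omega) with h1 | h1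
  · exact h1
  · have := S.dle _ _ h1; omega

theorem ds (S : Setup Adj s d A) : d s = 0 := (S.d0 s).2 rfl

theorem to_s (S : Setup Adj s d A) {v : V} (h : d v = 1) : Adj v s := by
  obtain ⟨w, hw, hw'⟩ := S.dsucc v 0 h
  rwa [(S.d0 w).1 hw'] at hw

/-- Assembling the conclusion. -/
theorem good (S : Setup Adj s d A) {P Q : Set V} (hP : TrOn Adj P) (hQ : TrOn Adj Q)
    (hs : s ∈ P ∪ Q) (hA : A ⊆ P ∪ Q) (hr : ∀ x ∈ P ∪ Q, Rch Adj s (P ∪ Q) x)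
    (hd : ∀ v, v ∉ P ∪ Q → ∃ x ∈ P ∪ Q, Adj v x) :
    ∃ P Q : Set V, TrOn Adj P ∧ TrOn Adj Q ∧ (P ∪ Q).Nonempty ∧
      StronglyConnectedOn Adj (P ∪ Q) ∧
      ∀ v, v ∉ P ∪ Q → (∃ x ∈ P ∪ Q, Adj v x) ∧ (∃ x ∈ P ∪ Q, Adj x v) := by
  have hin : ∀ v, v ≠ s → Adj s v ∨ ∃ x ∈ A, Adj s x ∧ Adj x v := by
    intro v hv
    have h0 : d v ≠ 0 := fun h => hv ((S.d0 v).1 h)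
    by_cases h1 : d v = 1
    · obtain ⟨x, hx, hxv⟩ := S.Adom v h1
      exact Or.inr ⟨x, hx, S.far (by rw [S.ds, S.Ad x hx]), hxv⟩
    · exact Or.inl (S.far (by rw [S.ds]; omega))
  refine ⟨P, Q, hP, hQ, ⟨s, hs⟩, ?_, fun v hv => ⟨hd v hv, ?_⟩⟩
  · intro u hu v hv
    refine (hr u hu).trans ?_
    by_cases e : v = s
    · rw [e]
    · rcases hin v e with h | ⟨x, hx, h1, h2⟩
      · exact Relation.ReflTransGen.single ⟨hs, hv, h⟩
      · exact (Relation.ReflTransGen.single ⟨hs, hA hx, h1⟩).tail ⟨hA hx, hv, h2⟩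
  · have e : v ≠ s := by rintro rfl; exact hv hs
    rcases hin v e with h | ⟨x, hx, h1, h2⟩
    · exact ⟨s, hs, h⟩
    · exact ⟨x, hA hx, h2⟩

theorem s_union (S : Setup Adj s d A) {B : Set V} (hB : TrOn Adj B) (h : ∀ x ∈ B, 2 ≤ d x) :
    TrOn Adj ({s} ∪ B) := by
  refine TrOn.union S.tour (TrOn.single S.tour s) hB ?_
  rintro p rfl q hq
  exact S.far (by rw [S.ds]; have := h q hq; omega)

/-- Chain structures ending at `e`. -/
def Chain (Adj : V → V → Prop) (s : V) (d : V → ℕ) (A : Set V) (i : ℕ) (e : V) : Prop :=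
  ∃ P Q : Set V, TrOn Adj P ∧ TrOn Adj Q ∧ s ∈ P ∪ Q ∧ A ⊆ P ∪ Q ∧ e ∈ P ∧
    (∀ x ∈ P, d x ≤ i) ∧ (∀ x ∈ Q, d x < i) ∧ ∀ x ∈ P ∪ Q, Rch Adj s (P ∪ Q) x

theorem A_ne (S : Setup Adj s d A) {v : V} (h : 1 ≤ d v) : A.Nonempty := by
  have : ∀ n v, d v = n + 1 → A.Nonempty := by
    intro n
    induction n with
    | zero => intro v hv; obtain ⟨x, hx, _⟩ := S.Adom v hv; exact ⟨x, hx⟩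
    | succ n ih => intro v hv; obtain ⟨w, _, hw⟩ := S.dsucc v _ hv; exact ih w hw
  exact this (d v - 1) v (by omega)

theorem chain_base [Finite V] (S : Setup Adj s d A) {e : V} (he : d e = 3) :
    Chain Adj s d A 3 e := by
  obtain ⟨a, haA, ha⟩ := exists_sink S.tour S.Atr (S.A_ne (v := e) (by omega))
  obtain ⟨b, hab, hb⟩ := S.dsucc a 1 (S.Ad a haA)
  have hbs := S.to_s hb
  have hsA : TrOn Adj ({s} ∪ A) := S.s_union S.Atr (fun x hx => (S.Ad x hx).ge)
  have hds := S.ds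
  have hAd := S.Ad
  by_cases h1 : ∃ α ∈ A, Adj e α
  · obtain ⟨α, hα, heα⟩ := h1
    refine ⟨{b, e}, {s} ∪ A, TrOn.pair S.tour b e, hsA, by simp, ?_, by simp, ?_, ?_, ?_⟩
    · intro x hx; simp [hx]
    · rintro x (rfl | rfl) <;> omega
    · rintro x (rfl | hx)
      · omega
      · have := hAd x hx; omega
    · have rb : Rch Adj s ({b, e} ∪ ({s} ∪ A)) b := Rch.root.step (by simp) (by simp) hbs
      have ra := rb.step (x := a) (by simp [haA]) (by simp) hab
      have rA := ra.sink (B := A) (fun x hx => by simp [hx]) haA ha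
      have re := (rA α hα).step (x := e) (by simp) (by simp [hα]) heα
      rintro x ((rfl | rfl) | (rfl | hx))
      · exact rb
      · exact re
      · exact Rch.root
      · exact rA x hx
  · push Not at h1
    have hAe : ∀ x ∈ A, Adj x e := by
      intro x hx
      rcases S.tour.total x e (by rintro rfl; have := hAd x hx; omega) with h | h
      · exact h
      · exact absurd h (h1 x hx)
    have hP : TrOn Adj ({s} ∪ A ∪ {e}) := by
      refine TrOn.union S.tour hsA (TrOn.single S.tour e) ?_
      rintro p (rfl | hp) q rfl
      · exact S.far (by omega)
      · exact hAe p hp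
    have hPd : ∀ x ∈ ({s} ∪ A ∪ {e} : Set V), d x ≤ 3 := by
      rintro x ((rfl | hx) | rfl)
      · omega
      · have := hAd x hx; omega
      · omega
    obtain ⟨q, heq, hq⟩ := S.dsucc e 2 he
    by_cases h2 : q ∈ A ∨ ∃ α ∈ A, Adj q α
    · refine ⟨_, {b, q}, hP, TrOn.pair S.tour b q, by simp, ?_, by simp, hPd, ?_, ?_⟩
      · intro x hx; simp [hx]
      · rintro x (rfl | rfl) <;> omega
      · have rb : Rch Adj s ({s} ∪ A ∪ {e} ∪ {b, q}) b := Rch.root.step (by simp) (by simp) hbs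
        have ra := rb.step (x := a) (by simp [haA]) (by simp) hab
        have rA := ra.sink (B := A) (fun x hx => by simp [hx]) haA ha
        have rq : Rch Adj s ({s} ∪ A ∪ {e} ∪ {b, q}) q := by
          rcases h2 with h2 | ⟨α, hα, h2⟩
          · exact rA q h2
          · exact (rA α hα).step (by simp) (by simp [hα]) h2
        have re := rq.step (x := e) (by simp) (by simp) heq
        rintro x (((rfl | hx) | rfl) | (rfl | rfl))
        · exact Rch.root
        · exact rA x hx
        · exact re
        · exact rb
        · exact rq
    · push Not at h2
      obtain ⟨p, hqp, hp⟩ := S.dsucc q 1 hq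
      have hps := S.to_s hp
      have hAq : ∀ x ∈ A, Adj x q := by
        intro x hx
        rcases S.tour.total x q (by rintro rfl; exact h2.1 hx) with h | h
        · exact h
        · exact absurd h (h2.2 x hx)
      refine ⟨_, {p, q}, hP, TrOn.pair S.tour p q, by simp, ?_, by simp, hPd, ?_, ?_⟩
      · intro x hx; simp [hx]
      · rintro x (rfl | rfl) <;> omega
      · have rp : Rch Adj s ({s} ∪ A ∪ {e} ∪ {p, q}) p := Rch.root.step (by simp) (by simp) hps
        have rq := rp.step (x := q) (by simp) (by simp) hqp
        have re := rq.step (x := e) (by simp) (by simp) heq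
        rintro x (((rfl | hx) | rfl) | (rfl | rfl))
        · exact Rch.root
        · exact rq.step (by simp [hx]) (by simp) (hAq x hx)
        · exact re
        · exact rp
        · exact rq

theorem chain [Finite V] (S : Setup Adj s d A) (i : ℕ) :
    ∀ e, d e = i + 3 → Chain Adj s d A (i + 3) e := by
  induction i with
  | zero => intro e he; exact S.chain_base he
  | succ i ih =>
    intro e' he'
    obtain ⟨e, hee, he⟩ := S.dsucc e' (i + 3) (by omega)
    obtain ⟨P, Q, hP, hQ, hs, hA, heP, hPd, hQd, hr⟩ := ih e he
    have hsub : P ∪ Q ⊆ (Q ∪ {e'}) ∪ P := by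
      rintro x (hx | hx) <;> simp [hx]
    refine ⟨Q ∪ {e'}, P, ?_, hP, hsub hs, hA.trans hsub, by simp, ?_, ?_, ?_⟩
    · refine TrOn.union S.tour hQ (TrOn.single S.tour e') ?_
      rintro p hp q rfl
      exact S.far (by have := hQd p hp; omega)
    · rintro x (hx | rfl)
      · have := hQd x hx; omega
      · omega
    · intro x hx; have := hPd x hx; omega
    · rintro x ((hx | rfl) | hx)
      · exact (hr x (Or.inr hx)).mono hsub
      · exact ((hr e (Or.inl heP)).mono hsub).step (by simp) (by simp [heP]) hee
      · exact (hr x (Or.inl hx)).mono hsub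

/-- The conclusion of the key lemma. -/
def Concl (Adj : V → V → Prop) : Prop :=
  ∃ P Q : Set V, TrOn Adj P ∧ TrOn Adj Q ∧ (P ∪ Q).Nonempty ∧
      StronglyConnectedOn Adj (P ∪ Q) ∧
      ∀ v, v ∉ P ∪ Q → (∃ x ∈ P ∪ Q, Adj v x) ∧ (∃ x ∈ P ∪ Q, Adj x v)

theorem case_large [Finite V] (S : Setup Adj s d A) {k : ℕ} (hk : ∀ v, d v ≤ k + 5)
    {z : V} (hz : d z = k + 5) : Concl Adj := by
  obtain ⟨B, hzB, hBd, hB, hBm⟩ := exists_max S.tour (I := {z}) (D := {v | d v = k + 5})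
    (TrOn.single S.tour z) (by simpa using hz)
  obtain ⟨u, huB, hu⟩ := exists_sink S.tour hB ⟨z, hzB rfl⟩
  obtain ⟨v, huv, hv⟩ := S.dsucc u (k + 4) (hBd huB)
  obtain ⟨C, hvC, hCd, hC, hCm⟩ := exists_max S.tour (I := {v}) (D := {v | d v = k + 4})
    (TrOn.single S.tour v) (by simpa using hv)
  obtain ⟨t, htC, ht⟩ := exists_sink S.tour hC ⟨v, hvC rfl⟩
  obtain ⟨e, hte, he⟩ := S.dsucc t (k + 3) (hCd htC)
  obtain ⟨P, Q, hP, hQ, hs, hA, heP, hPd, hQd, hr⟩ := S.chain k e he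
  have hsub : P ∪ Q ⊆ (Q ∪ C) ∪ (P ∪ B) := by
    rintro x (hx | hx) <;> simp [hx]
  have hvC' : v ∈ C := hvC rfl
  have hzB' : z ∈ B := hzB rfl
  refine S.good (P := Q ∪ C) (Q := P ∪ B) ?_ ?_ (hsub hs) (hA.trans hsub) ?_ ?_
  · refine TrOn.union S.tour hQ hC ?_
    intro p hp q hq
    have h1 := hQd p hp
    have h2 : d q = k + 4 := hCd hq
    exact S.far (by omega)
  · refine TrOn.union S.tour hP hB ?_
    intro p hp q hq
    have h1 := hPd p hp
    have h2 : d q = k + 5 := hBd hq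
    exact S.far (by omega)
  · have re := (hr e (Or.inl heP)).mono hsub
    have rt := re.step (x := t) (by simp [htC]) (by simp [heP]) hte
    have rC := rt.sink (B := C) (fun x hx => by simp [hx]) htC ht
    have ru := (rC v hvC').step (x := u) (by simp [huB]) (by simp [hvC']) huv
    have rB := ru.sink (B := B) (fun x hx => by simp [hx]) huB hu
    rintro x ((hx | hx) | (hx | hx))
    · exact (hr x (Or.inr hx)).mono hsub
    · exact rC x hx
    · exact (hr x (Or.inl hx)).mono hsub
    · exact rB x hx
  · intro w hw
    have hwC : w ∉ C := fun h => hw (by simp [h])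
    have hwB : w ∉ B := fun h => hw (by simp [h])
    by_cases h1 : d w = k + 5
    · obtain ⟨x, hx, hwx⟩ := (hBm w h1 hwB).1
      exact ⟨x, by simp [hx], hwx⟩
    by_cases h2 : d w = k + 4
    · obtain ⟨x, hx, hwx⟩ := (hCm w h2 hwC).1
      exact ⟨x, by simp [hx], hwx⟩
    exact ⟨z, by simp [hzB'], S.far (by have := hk w; omega)⟩

/-- A globally maximal transitive set together with a small transitive set. -/
theorem case_C (S : Setup Adj s d A) {C R : Set V} (hC : TrOn Adj C) (hR : TrOn Adj R)
    (hs : s ∈ C) (hA : A ⊆ C) (hm : ∀ v, v ∉ C → ∃ x ∈ C, Adj v x)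
    (hr : ∀ x ∈ C ∪ R, Rch Adj s (C ∪ R) x) : Concl Adj := by
  refine S.good hC hR (Or.inl hs) (hA.trans Set.subset_union_left) hr ?_
  intro v hv
  obtain ⟨x, hx, h⟩ := hm v (fun h => hv (Or.inl h))
  exact ⟨x, Or.inl hx, h⟩

theorem case_short (S : Setup Adj s d A) {C : Set V} (hC : TrOn Adj C)
    (hs : s ∈ C) (hA : A ⊆ C) (hm : ∀ v, v ∉ C → ∃ x ∈ C, Adj v x)
    {t : V} (htC : t ∈ C) (ht : ∀ x ∈ C, x ≠ t → Adj x t) (hd : d t ≤ 3) : Concl Adj := by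
  have h4 : d t = 0 ∨ d t = 1 ∨ d t = 2 ∨ d t = 3 := by omega
  rcases h4 with h | h | h | h
  · have e := (S.d0 t).1 h
    subst e
    refine S.case_C hC (TrOn.single S.tour t) hs hA hm ?_
    have rC := (Rch.root (Adj := Adj) (s := t) (X := C ∪ {t})).sink (B := C)
      (fun x hx => by simp [hx]) htC ht
    rintro x (hx | rfl)
    · exact rC x hx
    · exact Rch.root
  · refine S.case_C hC (TrOn.single S.tour t) hs hA hm ?_
    have rt : Rch Adj s (C ∪ {t}) t := Rch.root.step (by simp) (by simp [hs]) (S.to_s h)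
    have rC := rt.sink (B := C) (fun x hx => by simp [hx]) htC ht
    rintro x (hx | rfl)
    · exact rC x hx
    · exact rt
  · obtain ⟨p, htp, hp⟩ := S.dsucc t 1 h
    refine S.case_C hC (TrOn.single S.tour p) hs hA hm ?_
    have rp : Rch Adj s (C ∪ {p}) p := Rch.root.step (by simp) (by simp [hs]) (S.to_s hp)
    have rt := rp.step (x := t) (by simp [htC]) (by simp) htp
    have rC := rt.sink (B := C) (fun x hx => by simp [hx]) htC ht
    rintro x (hx | rfl)
    · exact rC x hx
    · exact rp
  · obtain ⟨q, htq, hq⟩ := S.dsucc t 2 h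
    obtain ⟨p, hqp, hp⟩ := S.dsucc q 1 hq
    refine S.case_C hC (TrOn.pair S.tour p q) hs hA hm ?_
    have rp : Rch Adj s (C ∪ {p, q}) p := Rch.root.step (by simp) (by simp [hs]) (S.to_s hp)
    have rq := rp.step (x := q) (by simp) (by simp) hqp
    have rt := rq.step (x := t) (by simp [htC]) (by simp) htq
    have rC := rt.sink (B := C) (fun x hx => by simp [hx]) htC ht
    rintro x (hx | (rfl | rfl))
    · exact rC x hx
    · exact rp
    · exact rq

/-- A maximal transitive set containing `s` and `A` has source `s`. -/
theorem d_of_mem (S : Setup Adj s d A) {C : Set V} (hC : TrOn Adj C)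
    (hs : s ∈ C) (hA : A ⊆ C) {x : V} (hx : x ∈ C) (hxs : x ≠ s) : 2 ≤ d x := by
  have h0 : d x ≠ 0 := fun h => hxs ((S.d0 x).1 h)
  by_contra h
  have h1 : d x = 1 := by omega
  obtain ⟨a, ha, hax⟩ := S.Adom x h1
  have h2 := hC a (hA ha) x hx s hs hax (S.to_s h1)
  have := S.dle _ _ h2
  rw [S.ds, S.Ad a ha] at this
  omega

theorem case_four [Finite V] (S : Setup Adj s d A) (hk : ∀ v, d v ≤ 4)
    {z : V} (hz : d z = 4) : Concl Adj := by
  have hds := S.ds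
  have hAd := S.Ad
  obtain ⟨B, hzB, hBd, hB, hBm⟩ := exists_max S.tour (I := {z}) (D := {v | d v = 4})
    (TrOn.single S.tour z) (by simpa using hz)
  have hBd' : ∀ x ∈ B, d x = 4 := fun x hx => hBd hx
  have hzB' : z ∈ B := hzB rfl
  obtain ⟨u, huB, hu⟩ := exists_sink S.tour hB ⟨z, hzB'⟩
  obtain ⟨v, huv, hv⟩ := S.dsucc u 3 (hBd huB)
  by_cases hcase : ∃ α ∈ A, Adj v α
  · -- use a globally maximal set
    obtain ⟨α, hα, hvα⟩ := hcase
    obtain ⟨b, hαb, hb⟩ := S.dsucc α 1 (hAd α hα)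
    have hI : TrOn Adj ({s} ∪ (A ∪ B)) := by
      refine S.s_union (TrOn.union S.tour S.Atr hB ?_) ?_
      · intro p hp q hq
        exact S.far (by have := hAd p hp; have := hBd' q hq; omega)
      · rintro x (hx | hx)
        · exact (hAd x hx).ge
        · have := hBd' x hx; omega
    obtain ⟨C, hIC, -, hC, hCm⟩ := exists_max S.tour hI (Set.subset_univ _)
    have hsC : s ∈ C := hIC (by simp)
    have hAC : A ⊆ C := fun x hx => hIC (by simp [hx])
    have hBC : B ⊆ C := fun x hx => hIC (by simp [hx])
    have hm : ∀ v, v ∉ C → ∃ x ∈ C, Adj v x := fun v hv => (hCm v trivial hv).1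
    obtain ⟨t, htC, ht⟩ := exists_sink S.tour hC ⟨s, hsC⟩
    by_cases hdt : d t ≤ 3
    · exact S.case_short hC hsC hAC hm htC ht hdt
    · have h4 : d t = 4 := by have := hk t; omega
      have htu : t = u := by
        by_contra hne
        have h1 := ht u (hBC huB) (Ne.symm hne)
        by_cases htB : t ∈ B
        · exact S.tour.asym _ _ h1 (hu t htB hne)
        · obtain ⟨x, hx, htx⟩ := (hBm t h4 htB).1
          exact S.tour.asym _ _ htx (ht x (hBC hx) (by rintro rfl; exact htB hx))
      subst htu
      refine S.case_C hC (TrOn.pair S.tour v b) hsC hAC hm ?_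
      have rb : Rch Adj s (C ∪ {v, b}) b := Rch.root.step (by simp) (by simp [hsC]) (S.to_s hb)
      have rα := rb.step (x := α) (by simp [hAC hα]) (by simp) hαb
      have rv := rα.step (x := v) (by simp) (by simp [hAC hα]) hvα
      have rt := rv.step (x := t) (by simp [htC]) (by simp) huv
      have rC := rt.sink (B := C) (fun x hx => by simp [hx]) htC ht
      rintro x (hx | (rfl | rfl))
      · exact rC x hx
      · exact rv
      · exact rb
  · push Not at hcase
    have hAv : ∀ x ∈ A, Adj x v := by
      intro x hx
      rcases S.tour.total x v (by rintro rfl; have := hAd x hx; omega) with h | h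
      · exact h
      · exact absurd h (hcase x hx)
    have hI : TrOn Adj (A ∪ {v}) := by
      refine TrOn.union S.tour S.Atr (TrOn.single S.tour v) ?_
      rintro p hp q rfl
      exact hAv p hp
    obtain ⟨C, hIC, hCd, hC, hCm⟩ := exists_max S.tour (D := {v | d v = 2 ∨ d v = 3}) hI (by
      rintro x (hx | rfl)
      · exact Or.inl (hAd x hx)
      · exact Or.inr hv)
    have hCd' : ∀ x ∈ C, d x = 2 ∨ d x = 3 := fun x hx => hCd hx
    have hAC : A ⊆ C := fun x hx => hIC (by simp [hx])
    have hvC : v ∈ C := hIC (by simp)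
    have hsC : TrOn Adj ({s} ∪ C) := S.s_union hC (fun x hx => by have := hCd' x hx; omega)
    obtain ⟨t, htC, ht⟩ := exists_sink S.tour hC ⟨v, hvC⟩
    -- a small exit set from `t`
    obtain ⟨R, hR, hRd, hRr⟩ : ∃ R : Set V, TrOn Adj R ∧ (∀ x ∈ R, d x ≤ 2) ∧
        ∀ X : Set V, s ∈ X → R ⊆ X → t ∈ X → Rch Adj s X t ∧ ∀ x ∈ R, Rch Adj s X x := by
      rcases hCd' t htC with h | h
      · obtain ⟨b, htb, hb⟩ := S.dsucc t 1 h
        refine ⟨{b}, TrOn.single S.tour b, by rintro x rfl; omega, fun X hsX hRX htX => ?_⟩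
        have hbX : b ∈ X := hRX rfl
        have rb : Rch Adj s X b := Rch.root.step hbX hsX (S.to_s hb)
        refine ⟨rb.step htX hbX htb, ?_⟩
        rintro x rfl
        exact rb
      · obtain ⟨q, htq, hq⟩ := S.dsucc t 2 h
        obtain ⟨p, hqp, hp⟩ := S.dsucc q 1 hq
        refine ⟨{p, q}, TrOn.pair S.tour p q, by rintro x (rfl | rfl) <;> omega,
          fun X hsX hRX htX => ?_⟩
        have hpX : p ∈ X := hRX (by simp)
        have hqX : q ∈ X := hRX (by simp)
        have rp : Rch Adj s X p := Rch.root.step hpX hsX (S.to_s hp)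
        have rq := rp.step hqX hpX hqp
        refine ⟨rq.step htX hqX htq, ?_⟩
        rintro x (rfl | rfl)
        · exact rp
        · exact rq
    refine S.good (P := {s} ∪ C) (Q := R ∪ B) hsC ?_ (by simp) ?_ ?_ ?_
    · refine TrOn.union S.tour hR hB ?_
      intro p hp q hq
      exact S.far (by have := hRd p hp; have := hBd' q hq; omega)
    · intro x hx; simp [hAC hx]
    · obtain ⟨rt, rR⟩ := hRr ({s} ∪ C ∪ (R ∪ B)) (by simp) (fun x hx => by simp [hx])
        (by simp [htC])
      have rC := rt.sink (B := C) (fun x hx => by simp [hx]) htC ht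
      have ru := (rC v hvC).step (x := u) (by simp [huB]) (by simp [hvC]) huv
      have rB := ru.sink (B := B) (fun x hx => by simp [hx]) huB hu
      rintro x ((rfl | hx) | (hx | hx))
      · exact Rch.root
      · exact rC x hx
      · exact rR x hx
      · exact rB x hx
    · intro w hw
      have hws : w ≠ s := by rintro rfl; exact hw (by simp)
      have h0 : d w ≠ 0 := fun h => hws ((S.d0 w).1 h)
      have hwC : w ∉ C := fun h => hw (by simp [h])
      have hwB : w ∉ B := fun h => hw (by simp [h])
      have h4 := hk w
      by_cases e1 : d w = 1
      · exact ⟨s, by simp, S.to_s e1⟩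
      by_cases e4 : d w = 4
      · obtain ⟨x, hx, hwx⟩ := (hBm w e4 hwB).1
        exact ⟨x, by simp [hx], hwx⟩
      have : d w = 2 ∨ d w = 3 := by omega
      obtain ⟨x, hx, hwx⟩ := (hCm w this hwC).1
      exact ⟨x, by simp [hx], hwx⟩

end Setup

/-- Key lemma: a strong tournament has a strong, 2-colourable, in- and out-dominating set. -/
theorem key_lemma {V : Type} [Finite V] [Nonempty V] {Adj : V → V → Prop} (h : Tour Adj)
    (hs : ∀ u v, Relation.ReflTransGen Adj u v) : Setup.Concl Adj := by
  obtain ⟨C, -, -, hC, hCm⟩ := exists_max h (I := ∅) (D := Set.univ)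
    (fun a ha => absurd ha (by simp)) (Set.subset_univ _)
  have hCne : C.Nonempty := by
    by_contra hc
    rw [Set.not_nonempty_iff_eq_empty] at hc
    subst hc
    obtain ⟨v⟩ := ‹Nonempty V›
    obtain ⟨⟨x, hx, _⟩, _⟩ := hCm v trivial (by simp)
    exact hx
  obtain ⟨s, hsC, hsrc⟩ := exists_source h hC hCne
  obtain ⟨d, d0, dle, dsucc⟩ := exists_dist s (fun v => hs v s)
  have S : Setup Adj s d {x ∈ C | d x = 2} := by
    refine ⟨h, d0, dle, dsucc, fun x hx => hx.2, hC.mono (fun x hx => hx.1), ?_⟩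
    intro w hw
    obtain ⟨s', hws, hs'⟩ := dsucc w 0 hw
    rw [(d0 s').1 hs'] at hws
    have hwne : w ≠ s := by rintro rfl; exact h.irr _ hws
    have hwC : w ∉ C := fun hwC => h.asym _ _ hws (hsrc w hwC hwne)
    obtain ⟨x, hx, hxw⟩ := (hCm w trivial hwC).2
    refine ⟨x, ⟨hx, ?_⟩, hxw⟩
    have h1 := dle x w hxw
    have hxs : x ≠ s := by rintro rfl; exact h.asym _ _ hws hxw
    have h2 : d x ≠ 0 := fun e => hxs ((d0 x).1 e)
    have h3 : d x ≠ 1 := by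
      intro e
      obtain ⟨s', hxs', hs'⟩ := dsucc x 0 e
      rw [(d0 s').1 hs'] at hxs'
      exact h.asym _ _ hxs' (hsrc x hx hxs)
    omega
  obtain ⟨z, hz⟩ := Finite.exists_max d
  obtain ⟨t, htC, ht⟩ := exists_sink h hC hCne
  by_cases h3 : d z ≤ 3
  · exact S.case_short hC hsC (fun x hx => hx.1) (fun v hv => (hCm v trivial hv).1) htC ht
      ((hz t).trans h3)
  by_cases h4 : d z = 4
  · exact S.case_four (fun v => h4 ▸ hz v) h4
  · exact S.case_large (k := d z - 5) (fun v => by have := hz v; omega) (z := z) (by omega)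

/-- Key lemma relative to a set. -/
theorem key_lemma_on {V : Type} [Finite V] {Adj : V → V → Prop} (h : Tour Adj) {S : Set V}
    (hne : S.Nonempty) (hs : StronglyConnectedOn Adj S) :
    ∃ P Q : Set V, P ⊆ S ∧ Q ⊆ S ∧ TrOn Adj P ∧ TrOn Adj Q ∧ (P ∪ Q).Nonempty ∧
      StronglyConnectedOn Adj (P ∪ Q) ∧
      ∀ v ∈ S, v ∉ P ∪ Q → (∃ x ∈ P ∪ Q, Adj v x) ∧ (∃ x ∈ P ∪ Q, Adj x v) := by
  have : Nonempty S := hne.to_subtype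
  have hT : Tour (fun a b : S => Adj a b) :=
    ⟨fun u v => h.asym u v, fun u v e => h.total u v (fun h => e (Subtype.ext h))⟩
  have hstr : ∀ u v : S, Relation.ReflTransGen (fun a b : S => Adj a b) u v := by
    rintro ⟨u, hu⟩ ⟨v, hv⟩
    have key : ∀ w, Relation.ReflTransGen (fun a b => a ∈ S ∧ b ∈ S ∧ Adj a b) u w →
        ∃ hw : w ∈ S, Relation.ReflTransGen (fun a b : S => Adj a b) ⟨u, hu⟩ ⟨w, hw⟩ := by
      intro w hw
      induction hw with
      | refl => exact ⟨hu, Relation.ReflTransGen.refl⟩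
      | tail _ h2 ih => obtain ⟨_, ih⟩ := ih; exact ⟨h2.2.1, ih.tail h2.2.2⟩
    exact (key v (hs hu hv)).2
  obtain ⟨P, Q, hP, hQ, hn, hsc, hd⟩ := key_lemma hT hstr
  have tr : ∀ P : Set S, TrOn (fun a b : S => Adj a b) P → TrOn Adj (Subtype.val '' P) := by
    rintro P hP _ ⟨a, ha, rfl⟩ _ ⟨b, hb, rfl⟩ _ ⟨c, hc, rfl⟩ h1 h2
    exact hP a ha b hb c hc h1 h2
  refine ⟨Subtype.val '' P, Subtype.val '' Q, by simp, by simp, tr P hP, tr Q hQ, ?_, ?_, ?_⟩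
  · rw [← Set.image_union]; exact hn.image _
  · rw [← Set.image_union]
    rintro _ ⟨u, hu, rfl⟩ _ ⟨v, hv, rfl⟩
    refine Relation.ReflTransGen.lift Subtype.val ?_ _ _ (hsc hu hv)
    rintro a b ⟨ha, hb, hab⟩
    exact ⟨⟨a, ha, rfl⟩, ⟨b, hb, rfl⟩, hab⟩
  · rw [← Set.image_union]
    intro v hv hvn
    obtain ⟨⟨x, hx, h1⟩, ⟨y, hy, h2⟩⟩ := hd ⟨v, hv⟩ (fun hm => hvn ⟨_, hm, rfl⟩)
    exact ⟨⟨x, ⟨x, hx, rfl⟩, h1⟩, ⟨y, ⟨y, hy, rfl⟩, h2⟩⟩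

/-- Colourability by transitive sets. -/
def TrCol {V : Type} (Adj : V → V → Prop) (S : Set V) (k : ℕ) : Prop :=
  ∃ c : V → ℕ, (∀ v ∈ S, c v < k) ∧ ∀ i : ℕ, TrOn Adj {v ∈ S | c v = i}

theorem TrCol.di {V : Type} {Adj : V → V → Prop} (h : Tour Adj) {S : Set V} {k : ℕ}
    (hc : TrCol Adj S k) : DiColorableOn Adj S k := by
  obtain ⟨c, h1, h2⟩ := hc
  exact ⟨c, h1, fun i => (h2 i).acyclic h⟩

/-- A minimal non-colourable set is strong. -/
theorem strong_of_minimal {V : Type} {Adj : V → V → Prop} (h : Tour Adj) {S : Set V}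
    {k : ℕ} (hn : ¬ TrCol Adj S k) (hmin : ∀ T, T ⊆ S → T ≠ S → TrCol Adj T k) :
    StronglyConnectedOn Adj S := by
  classical
  intro u hu v hv
  by_contra hc
  set U : Set V := {w ∈ S | Relation.ReflTransGen (fun a b => a ∈ S ∧ b ∈ S ∧ Adj a b) u w}
    with hU
  have hUS : U ⊆ S := fun x hx => hx.1
  have huU : u ∈ U := ⟨hu, Relation.ReflTransGen.refl⟩
  have hvU : v ∉ U := fun hv => hc hv.2
  have hcross : ∀ p ∈ S \ U, ∀ q ∈ U, Adj p q := by
    intro p hp q hq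
    rcases h.total p q (by rintro rfl; exact hp.2 hq) with h1 | h1
    · exact h1
    · exact absurd ⟨hp.1, hq.2.tail ⟨hq.1, hp.1, h1⟩⟩ hp.2
  obtain ⟨c1, a1, b1⟩ := hmin U hUS (fun e => hvU (e ▸ hv))
  obtain ⟨c2, a2, b2⟩ := hmin (S \ U) Set.sdiff_subset (fun e => by
    have : u ∈ S \ U := e.symm ▸ hu
    exact this.2 huU)
  refine hn ⟨fun x => if x ∈ U then c1 x else c2 x, ?_, fun i => ?_⟩
  · intro x hx
    by_cases hxU : x ∈ U
    · simpa [hxU] using a1 x hxU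
    · simpa [hxU] using a2 x ⟨hx, hxU⟩
  · refine (TrOn.union h (b2 i) (b1 i) (fun p hp q hq => hcross p hp.1 q hq.1)).mono ?_
    rintro x ⟨hx, hxi⟩
    by_cases hxU : x ∈ U
    · right; exact ⟨hxU, by simpa [hxU] using hxi⟩
    · left; exact ⟨⟨hx, hxU⟩, by simpa [hxU] using hxi⟩

theorem main_induction {V : Type} [Finite V] {Adj : V → V → Prop} (h : Tour Adj) (r : ℕ) :
    ∀ S : Set V, ¬ TrCol Adj S (2 * r) → ∃ X : Fin (r + 1) → Set V,
      (∀ i, X i ⊆ S) ∧ (∀ i, (X i).Nonempty) ∧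
      (∀ i j, i ≠ j → Disjoint (X i) (X j)) ∧
      (∀ i, StronglyConnectedOn Adj (X i)) ∧
      (∀ i j, i ≠ j → ∃ u ∈ X i, ∃ v ∈ X j, Adj u v) := by
  classical
  induction r with
  | zero =>
    intro S hS
    have hne : S.Nonempty := by
      by_contra hc
      rw [Set.not_nonempty_iff_eq_empty] at hc
      subst hc
      exact hS ⟨fun _ => 0, by simp, fun i a ha => absurd ha.1 (by simp)⟩
    obtain ⟨x, hx⟩ := hne
    refine ⟨fun _ => {x}, by simpa using hx, by simp, ?_, ?_, ?_⟩
    · intro i j hij; exact absurd (Subsingleton.elim (α := Fin 1) i j) hij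
    · rintro i u rfl v rfl; exact Relation.ReflTransGen.refl
    · intro i j hij; exact absurd (Subsingleton.elim (α := Fin 1) i j) hij
  | succ r ih =>
    intro S0 hS0
    have hf : {S : Set V | S ⊆ S0 ∧ ¬ TrCol Adj S (2 * (r + 1))}.Finite := Set.toFinite _
    obtain ⟨S, ⟨hSS, hS⟩, hmin⟩ := hf.exists_minimal ⟨S0, subset_rfl, hS0⟩
    have hstr : StronglyConnectedOn Adj S := by
      refine strong_of_minimal h hS (fun T hT hne => ?_)
      by_contra hTc
      exact hne (hT.antisymm (hmin ⟨hT.trans hSS, hTc⟩ hT))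
    have hne : S.Nonempty := by
      by_contra hc
      rw [Set.not_nonempty_iff_eq_empty] at hc
      subst hc
      exact hS ⟨fun _ => 0, by simp, fun i a ha => absurd ha.1 (by simp)⟩
    obtain ⟨P, Q, hPS, hQS, hP, hQ, hn, hsc, hd⟩ := key_lemma_on h hne hstr
    have hrest : ¬ TrCol Adj (S \ (P ∪ Q)) (2 * r) := by
      rintro ⟨c, c1, c2⟩
      refine hS ⟨fun x => if x ∈ P then 2 * r else if x ∈ Q then 2 * r + 1 else c x, ?_, ?_⟩
      · intro x hx
        by_cases hxP : x ∈ P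
        · simp [hxP]
        by_cases hxQ : x ∈ Q
        · simp [hxP, hxQ]; omega
        have := c1 x ⟨hx, by simp [hxP, hxQ]⟩
        simp [hxP, hxQ]; omega
      · intro i
        have key : ∀ x ∈ S, x ∉ P → x ∉ Q → c x < 2 * r :=
          fun x hx hxP hxQ => c1 x ⟨hx, by simp [hxP, hxQ]⟩
        by_cases i0 : i = 2 * r
        · refine hP.mono ?_
          rintro x ⟨hx, hxi⟩
          by_contra hxP
          have := key x hx hxP
          grind
        by_cases i1 : i = 2 * r + 1
        · refine hQ.mono ?_
          rintro x ⟨hx, hxi⟩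
          by_contra hxQ
          have := key x hx
          grind
        · refine (c2 i).mono ?_
          rintro x ⟨hx, hxi⟩
          have hxP : x ∉ P := by intro hxP; simp [hxP] at hxi; omega
          have hxQ : x ∉ Q := by intro hxQ; simp [hxP, hxQ] at hxi; omega
          exact ⟨⟨hx, by simp [hxP, hxQ]⟩, by simpa [hxP, hxQ] using hxi⟩
    obtain ⟨X, x1, x2, x3, x4, x5⟩ := ih _ hrest
    have hdis : ∀ i, Disjoint (P ∪ Q) (X i) := fun i =>
      Set.disjoint_left.2 (fun y hy hyi => (x1 i hyi).2 hy)
    refine ⟨Fin.cons (P ∪ Q) X, ?_, ?_, ?_, ?_, ?_⟩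
    · intro i
      refine Fin.cases ?_ (fun i => ?_) i
      · exact (Set.union_subset hPS hQS).trans hSS
      · exact ((x1 i).trans Set.sdiff_subset).trans hSS
    · intro i
      refine Fin.cases ?_ (fun i => ?_) i
      · exact hn
      · exact x2 i
    · intro i j
      refine Fin.cases ?_ (fun i => ?_) i <;> refine Fin.cases ?_ (fun j => ?_) j
      · intro hij; exact absurd rfl hij
      · intro _; exact hdis j
      · intro _; exact (hdis i).symm
      · intro hij; exact x3 i j (fun e => hij (e ▸ rfl))
    · intro i
      refine Fin.cases ?_ (fun i => ?_) i
      · exact hsc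
      · exact x4 i
    · intro i j
      refine Fin.cases ?_ (fun i => ?_) i <;> refine Fin.cases ?_ (fun j => ?_) j
      · intro hij; exact absurd rfl hij
      · intro _
        obtain ⟨y, hy⟩ := x2 j
        obtain ⟨x, hx, hxy⟩ := (hd y (x1 j hy).1 (x1 j hy).2).2
        exact ⟨x, hx, y, hy, hxy⟩
      · intro _
        obtain ⟨y, hy⟩ := x2 i
        obtain ⟨x, hx, hxy⟩ := (hd y (x1 i hy).1 (x1 i hy).2).1
        exact ⟨y, hy, x, hx, hxy⟩
      · intro hij; exact x5 i j (fun e => hij (e ▸ rfl))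

/-- every tournament `T` with dichromatic number at least `2r`
(`r ≥ 1`) contains a strong `K⃗ r` minor. -/
theorem tournament_chi_ge_two_r_strong_minor
    {V : Type} [Fintype V] (Adj : V → V → Prop) (hT : IsTournament Adj)
    (r : ℕ) (hr : 1 ≤ r)
    (hchi : 2 * r ≤ dichromaticNumberOn Adj Set.univ) :
    ContainsStrongCompleteMinor Adj r := by
  have h := Tour.of hT
  obtain ⟨r, rfl⟩ : ∃ q, r = q + 1 := ⟨r - 1, by omega⟩
  have hn : ¬ TrCol Adj Set.univ (2 * r) := by
    intro hc
    have : dichromaticNumberOn Adj Set.univ ≤ 2 * r := Nat.sInf_le (hc.di h)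
    omega
  obtain ⟨X, _, x2, x3, x4, x5⟩ := main_induction h r Set.univ hn
  exact ⟨X, x2, x3, x4, x5⟩
end

section
/- For every integer r ≥ 2 there exists a tournament S_r such that χ(S_r) = r and sm(S_r) ≤ r − 1, i.e. S_r has dichromatic number exactly r but contains no strong K⃗_r minor. -/
/-- One point `none`, and two copies of `V`, arranged cyclically. -/
def triAdj {V : Type} (Adj : V → V → Prop) : Option (Bool × V) → Option (Bool × V) → Prop
  | none, none => False
  | none, some (b, _) => b = false
  | some (b, _), none => b = true
  | some (b, x), some (b', y) => (b = b' ∧ Adj x y) ∨ (b = false ∧ b' = true)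

theorem acyclicOn_map {V W : Type} {A : V → V → Prop} {B : W → W → Prop} (f : V → W)
    (hf : ∀ x y, A x y → B (f x) (f y)) {S : Set V} {T : Set W}
    (hST : ∀ x ∈ S, f x ∈ T) (hT : AcyclicOn B T) : AcyclicOn A S := by
  intro v hv h
  refine hT (f v) (hST v hv) ?_
  exact Relation.TransGen.lift f (fun a b hab => ⟨hST a hab.1, hST b hab.2.1, hf a b hab.2.2⟩) _ _ h

theorem tri_tournament {V : Type} {A : V → V → Prop} (h : IsTournament A) :
    IsTournament (triAdj A) := by
  obtain ⟨h1, h2⟩ := h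
  constructor
  · rintro (_ | ⟨b, x⟩)
    · simp [triAdj]
    · have := h1 x
      cases b <;> simp [triAdj, this]
  · rintro (_ | ⟨b, x⟩) (_ | ⟨b', y⟩) hne
    · exact absurd rfl hne
    · cases b' <;> simp [triAdj]
    · cases b <;> simp [triAdj]
    · have := h2 x y
      cases b <;> cases b' <;> simp_all [triAdj]

theorem tri_lower {V : Type} {A : V → V → Prop} {r : ℕ}
    (h : ∀ k, DiColorableOn A Set.univ k → r ≤ k) :
    ∀ k, DiColorableOn (triAdj A) Set.univ k → r + 1 ≤ k := by
  rintro k ⟨c, hc, hac⟩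
  have hn := hc none trivial
  obtain ⟨k', rfl⟩ : ∃ k', k = k' + 1 := ⟨k - 1, by omega⟩
  by_contra hlt
  have key : ∀ b : Bool, ∃ x, c (some (b, x)) = c none := by
    intro b
    by_contra hno
    push Not at hno
    have : r ≤ k' := by
      apply h
      refine ⟨fun x => if c (some (b, x)) = k' then c none else c (some (b, x)), ?_, ?_⟩
      · intro v _
        have h1 := hc (some (b, v)) trivial
        have h2 := hno v
        dsimp only
        split_ifs <;> omega
      · intro j
        refine acyclicOn_map (fun x => some (b, x)) ?_ ?_ (hac (if j = c none then k' else j))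
        · intro x y hxy
          exact Or.inl ⟨rfl, hxy⟩
        · intro x hx
          have h2 := hno x
          have hx2 := hx.2
          dsimp only at hx2
          refine ⟨trivial, ?_⟩
          split_ifs at hx2 ⊢ <;> omega
    omega
  obtain ⟨x, hx⟩ := key false
  obtain ⟨y, hy⟩ := key true
  refine hac (c none) none ⟨trivial, rfl⟩ ?_
  refine .tail (.tail (.single (b := some (false, x)) ?_) (c := some (true, y)) ?_) ?_
  · exact ⟨⟨trivial, rfl⟩, ⟨trivial, hx⟩, rfl⟩
  · exact ⟨⟨trivial, hx⟩, ⟨trivial, hy⟩, Or.inr ⟨rfl, rfl⟩⟩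
  · exact ⟨⟨trivial, hy⟩, ⟨trivial, rfl⟩, rfl⟩

theorem tri_upper {V : Type} {A : V → V → Prop} {r : ℕ}
    (h : DiColorableOn A Set.univ r) : DiColorableOn (triAdj A) Set.univ (r + 1) := by
  obtain ⟨c, hc, hac⟩ := h
  set c' : Option (Bool × V) → ℕ := fun o => o.elim r (fun p => c p.2) with hc'
  refine ⟨c', ?_, ?_⟩
  · rintro (_ | ⟨b, x⟩) _
    · simp [hc']
    · have := hc x trivial
      simp only [hc', Option.elim]; omega
  · rintro j (_ | ⟨b, x⟩) hv hcyc
    · have hj : r = j := hv.2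
      obtain ⟨w, hw, -⟩ := Relation.TransGen.head'_iff.1 hcyc
      rcases w with _ | ⟨b, x⟩
      · exact hw.2.2
      · have h1 : c x = j := hw.2.1.2
        have := hc x trivial
        omega
    · have hxj : c x = j := hv.2
      have hxr := hc x trivial
      have key : ∀ w, Relation.TransGen (fun a b => a ∈ {v ∈ Set.univ | c' v = j} ∧
          b ∈ {v ∈ Set.univ | c' v = j} ∧ triAdj A a b) (some (b, x)) w →
          ∃ b' y, w = some (b', y) ∧ ((b = b' ∧ Relation.TransGen
            (fun a b => a ∈ {v ∈ Set.univ | c v = j} ∧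
              b ∈ {v ∈ Set.univ | c v = j} ∧ A a b) x y) ∨ (b = false ∧ b' = true)) := by
        intro w hw
        induction hw with
        | @single w hw =>
          rcases w with _ | ⟨b', y⟩
          · have : r = j := hw.2.1.2
            omega
          · refine ⟨b', y, rfl, ?_⟩
            rcases hw.2.2 with h | h
            · exact Or.inl ⟨h.1, .single ⟨⟨trivial, hxj⟩, ⟨trivial, hw.2.1.2⟩, h.2⟩⟩
            · exact Or.inr h
        | @tail u w _ hw ih =>
          obtain ⟨b1, z, rfl, ih⟩ := ih
          rcases w with _ | ⟨b', y⟩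
          · have : r = j := hw.2.1.2
            omega
          · refine ⟨b', y, rfl, ?_⟩
            rcases hw.2.2 with h | h
            · rcases ih with ih | ih
              · exact Or.inl ⟨ih.1.trans h.1,
                  .tail ih.2 ⟨⟨trivial, hw.1.2⟩, ⟨trivial, hw.2.1.2⟩, h.2⟩⟩
              · exact Or.inr ⟨ih.1, h.1 ▸ ih.2⟩
            · refine Or.inr ⟨?_, h.2⟩
              rcases ih with ih | ih
              · exact ih.1.trans h.1
              · exact ih.1
      obtain ⟨b', y, he, hh⟩ := key _ hcyc
      obtain ⟨rfl, rfl⟩ : b = b' ∧ x = y := by simpa using he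
      rcases hh with hh | hh
      · exact hac j x ⟨trivial, hxj⟩ hh.2
      · exact absurd (hh.1.symm.trans hh.2) (by decide)

theorem tri_minor {V : Type} {A : V → V → Prop} {r : ℕ} (hr : 1 ≤ r)
    (h : ContainsStrongCompleteMinor (triAdj A) (r + 1)) : ContainsStrongCompleteMinor A r := by
  obtain ⟨X, hne, hdis, hsc, hE⟩ := h
  obtain ⟨i0, hi0⟩ : ∃ i0, ∀ i, i ≠ i0 → none ∉ X i := by
    by_cases hex : ∃ i, none ∈ X i
    · obtain ⟨i, hi⟩ := hex
      exact ⟨i, fun j hj hjn => Set.disjoint_left.1 (hdis j i hj) hjn hi⟩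
    · push Not at hex
      exact ⟨0, fun i _ => hex i⟩
  have mono : ∀ i, i ≠ i0 → ∀ x w, some (true, x) ∈ X i → w ∈ X i →
      ∃ y, w = some (true, y) := by
    intro i hi x w hx hw
    have hp := hsc i hx hw
    clear hw
    induction hp with
    | refl => exact ⟨x, rfl⟩
    | @tail u w _ hw ih =>
      obtain ⟨y, rfl⟩ := ih
      rcases w with _ | ⟨b, z⟩
      · exact absurd hw.2.1 (hi0 i hi)
      · rcases hw.2.2 with h | h
        · exact ⟨z, by rw [← h.1]⟩
        · exact absurd h.1 (by decide)
  have hb : ∀ i, i ≠ i0 → ∃ b : Bool, ∀ w ∈ X i, ∃ y, w = some (b, y) := by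
    intro i hi
    by_cases hex : ∃ x, some (true, x) ∈ X i
    · obtain ⟨x, hx⟩ := hex
      exact ⟨true, fun w hw => mono i hi x w hx hw⟩
    · push Not at hex
      refine ⟨false, ?_⟩
      rintro (_ | ⟨b, z⟩) hw
      · exact absurd hw (hi0 i hi)
      · cases b
        · exact ⟨z, rfl⟩
        · exact absurd hw (hex z)
  have hb' : ∀ k : Fin r, ∃ b : Bool, ∀ w ∈ X (i0.succAbove k), ∃ y, w = some (b, y) :=
    fun k => hb _ (Fin.succAbove_ne i0 k)
  choose β hβ using hb'
  have hinj : ∀ k l : Fin r, k ≠ l → i0.succAbove k ≠ i0.succAbove l :=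
    fun k l hkl he => hkl (Fin.succAbove_right_injective he)
  have hle : ∀ k l, k ≠ l → β k = true → β l = true := by
    intro k l hkl hk
    obtain ⟨u, hu, v, hv, huv⟩ := hE _ _ (hinj k l hkl)
    obtain ⟨x, rfl⟩ := hβ k u hu
    obtain ⟨y, rfl⟩ := hβ l v hv
    rcases huv with h | h
    · rw [← h.1, hk]
    · exact h.2
  obtain ⟨b, hβb⟩ : ∃ b, ∀ k, β k = b := by
    refine ⟨β ⟨0, hr⟩, fun k => ?_⟩
    by_cases hk : k = ⟨0, hr⟩
    · rw [hk]
    · exact Bool.eq_iff_iff.2 ⟨hle _ _ hk, hle _ _ (Ne.symm hk)⟩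
  simp only [hβb] at hβ
  refine ⟨fun k => {x | some (b, x) ∈ X (i0.succAbove k)}, ?_, ?_, ?_, ?_⟩
  · intro k
    obtain ⟨u, hu⟩ := hne (i0.succAbove k)
    obtain ⟨x, rfl⟩ := hβ k u hu
    exact ⟨x, hu⟩
  · intro k l hkl
    exact Set.disjoint_left.2 fun x hx hy =>
      Set.disjoint_left.1 (hdis _ _ (hinj k l hkl)) hx hy
  · intro k x hx y hy
    have hp := Relation.ReflTransGen.lift (fun o : Option (Bool × V) => o.elim x Prod.snd)
      (p := fun a c => a ∈ {x | some (b, x) ∈ X (i0.succAbove k)} ∧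
        c ∈ {x | some (b, x) ∈ X (i0.succAbove k)} ∧ A a c) ?_ _ _ (hsc _ hx hy)
    · exact hp
    · rintro u v ⟨hu, hv, huv⟩
      obtain ⟨x', rfl⟩ := hβ k u hu
      obtain ⟨y', rfl⟩ := hβ k v hv
      refine ⟨hu, hv, ?_⟩
      rcases huv with h | h
      · exact h.2
      · exact absurd (h.1.symm.trans h.2) (by decide)
  · intro k l hkl
    obtain ⟨u, hu, v, hv, huv⟩ := hE _ _ (hinj k l hkl)
    obtain ⟨x, rfl⟩ := hβ k u hu
    obtain ⟨y, rfl⟩ := hβ l v hv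
    refine ⟨x, hu, y, hv, ?_⟩
    rcases huv with h | h
    · exact h.2
    · exact absurd (h.1.symm.trans h.2) (by decide)

theorem no_two_minor {V : Type} {A : V → V → Prop} (ht : IsTournament A)
    (hu : ∀ a b c, A a b → A a c → b = c) : ¬ ContainsStrongCompleteMinor A 2 := by
  rintro ⟨X, hne, hdis, hsc, hE⟩
  have key : ∀ i j : Fin 2, i ≠ j → ∀ v ∈ X i, ∀ w ∈ X i, ∀ p ∈ X j, A v p → v = w := by
    intro i j hij v hv w hw p hp hvp
    rcases Relation.ReflTransGen.cases_head (hsc i hv hw) with h | ⟨q, hq, -⟩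
    · exact h
    · have := hu _ _ _ hvp hq.2.2
      subst this
      exact absurd hp (Set.disjoint_left.1 (hdis i j hij) hq.2.1)
  obtain ⟨u, hu0, v, hv1, huv⟩ := hE 0 1 (by decide)
  obtain ⟨v', hv', u', hu', hvu⟩ := hE 1 0 (by decide)
  obtain rfl := key 0 1 (by decide) u hu0 u' hu' v hv1 huv
  obtain rfl := key 1 0 (by decide) v' hv' v hv1 u hu0 hvu
  have hne : u ≠ v' := fun h => ht.1 u (by rw [← h] at huv; exact huv)
  exact (ht.2 u v' hne).1 huv hvu

theorem exists_type_aux (m : ℕ) :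
    ∃ (V : Type) (_ : Finite V) (A : V → V → Prop), IsTournament A ∧
      DiColorableOn A Set.univ (m + 2) ∧ (∀ k, DiColorableOn A Set.univ k → m + 2 ≤ k) ∧
      ¬ ContainsStrongCompleteMinor A (m + 2) := by
  induction m with
  | zero =>
    have ht : IsTournament (fun _ _ : Unit => False) :=
      ⟨fun _ h => h, fun u v h => absurd (Subsingleton.elim u v) h⟩
    refine ⟨Option (Bool × Unit), inferInstance, triAdj (fun _ _ => False),
      tri_tournament ht, tri_upper ?_, tri_lower ?_, no_two_minor (tri_tournament ht) ?_⟩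
    · refine ⟨fun _ => 0, by simp, fun i v _ h => ?_⟩
      obtain ⟨w, hw, -⟩ := Relation.TransGen.head'_iff.1 h
      exact hw.2.2
    · rintro k ⟨c, hc, -⟩
      have := hc () trivial
      omega
    · rintro (_ | ⟨_ | _, _⟩) (_ | ⟨_ | _, _⟩) (_ | ⟨_ | _, _⟩) <;> simp [triAdj]
  | succ m ih =>
    obtain ⟨V, hV, A, h1, h2, h3, h4⟩ := ih
    exact ⟨Option (Bool × V), inferInstance, triAdj A, tri_tournament h1, tri_upper h2,
      tri_lower h3, fun h => h4 (tri_minor (by omega) h)⟩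

/-- for every `r ≥ 2` there is a tournament with dichromatic
number exactly `r` containing no strong `K⃗ r` minor. -/
theorem exists_tournament_chi_eq_r_no_strong_minor (r : ℕ) (hr : 2 ≤ r) :
    ∃ (n : ℕ) (Adj : Fin n → Fin n → Prop),
      IsTournament Adj ∧
      dichromaticNumberOn Adj Set.univ = r ∧
      ¬ ContainsStrongCompleteMinor Adj r := by
  obtain ⟨m, rfl⟩ : ∃ m, r = m + 2 := ⟨r - 2, by omega⟩
  obtain ⟨V, hV, A, h1, h2, h3, h4⟩ := exists_type_aux m
  obtain ⟨n, ⟨e⟩⟩ := Finite.exists_equiv_fin V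
  refine ⟨n, fun a b => A (e.symm a) (e.symm b), ⟨fun a => h1.1 _, fun u v huv =>
    h1.2 _ _ (fun h => huv (e.symm.injective h))⟩, ?_, ?_⟩
  · apply le_antisymm
    · apply Nat.sInf_le
      obtain ⟨c, hc, hac⟩ := h2
      exact ⟨fun a => c (e.symm a), fun v _ => hc _ trivial, fun i =>
        acyclicOn_map e.symm (fun _ _ h => h) (T := {v ∈ Set.univ | c v = i})
            (fun x hx => ⟨trivial, hx.2⟩) (hac i)⟩
    · apply le_csInf
      · obtain ⟨c, hc, hac⟩ := h2
        exact ⟨m + 2, fun a => c (e.symm a), fun v _ => hc _ trivial, fun i =>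
          acyclicOn_map e.symm (fun _ _ h => h) (T := {v ∈ Set.univ | c v = i})
            (fun x hx => ⟨trivial, hx.2⟩) (hac i)⟩
      · rintro k ⟨c, hc, hac⟩
        exact h3 k ⟨fun a => c (e a), fun v _ => hc _ trivial, fun i =>
          acyclicOn_map e (fun x y h => by simpa using h) (T := {v ∈ Set.univ | c v = i})
            (fun x hx => ⟨trivial, hx.2⟩) (hac i)⟩
  · rintro ⟨X, hne, hdis, hsc, hE⟩
    refine h4 ⟨fun i => {x | e x ∈ X i}, ?_, ?_, ?_, ?_⟩
    · intro i
      obtain ⟨x, hx⟩ := hne i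
      exact ⟨e.symm x, by simpa using hx⟩
    · intro i j hij
      exact Set.disjoint_left.2 fun x hx hy => Set.disjoint_left.1 (hdis i j hij) hx hy
    · intro i x hx y hy
      have hp := Relation.ReflTransGen.lift e.symm
        (p := fun a c => a ∈ {x | e x ∈ X i} ∧ c ∈ {x | e x ∈ X i} ∧ A a c)
        (fun u v h => ⟨by simpa using h.1, by simpa using h.2.1, h.2.2⟩) _ _ (hsc i hx hy)
      simpa [Function.onFun] using hp
    · intro i j hij
      obtain ⟨u, hu, v, hv, huv⟩ := hE i j hij
      exact ⟨e.symm u, by simpa using hu, e.symm v, by simpa using hv, huv⟩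
end

section
/- There exists a constant C > 0 such that for every positive integer r, every tournament T with minimum out-degree δ⁺(T) ≥ C·r·√(log r) contains a strong K⃗_r minor, i.e. sm(T) ≥ r. -/
section Helpers
open scoped Classical

variable {V : Type}

/-- Adjacency restricted to a set. -/
def RelOn (Adj : V → V → Prop) (S : Set V) : V → V → Prop :=
  fun a b => a ∈ S ∧ b ∈ S ∧ Adj a b

theorem relOn_mono {Adj : V → V → Prop} {S S' : Set V} (h : S ⊆ S') {a b : V}
    (hab : Relation.ReflTransGen (RelOn Adj S) a b) :
    Relation.ReflTransGen (RelOn Adj S') a b :=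
  Relation.ReflTransGen.mono (fun _ _ h' => ⟨h h'.1, h h'.2.1, h'.2.2⟩) _ _ hab

/-- A median order. -/
structure MedOrder [Fintype V] (Adj : V → V → Prop) (pos : V → ℕ) : Prop where
  inj : Function.Injective pos
  lt : ∀ v, pos v < Fintype.card V
  surj : ∀ p < Fintype.card V, ∃ v, pos v = p
  star : ∀ l : V → ℕ,
    (Finset.univ.filter (fun p : V × V => pos p.1 < pos p.2 ∧ l p.2 < l p.1 ∧ Adj p.2 p.1)).card ≤
    (Finset.univ.filter (fun p : V × V => pos p.1 < pos p.2 ∧ l p.2 < l p.1 ∧ Adj p.1 p.2)).card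

noncomputable def fwdCount [Fintype V] (Adj : V → V → Prop) (f : V → ℕ) : ℕ :=
  (Finset.univ.filter (fun p : V × V => Adj p.1 p.2 ∧ f p.1 < f p.2)).card

theorem exists_max_fwd [Fintype V] (Adj : V → V → Prop) :
    ∃ f : V → ℕ, Function.Injective f ∧
      ∀ f' : V → ℕ, Function.Injective f' → fwdCount Adj f' ≤ fwdCount Adj f := by
  let S : Set ℕ := {k | ∃ f : V → ℕ, Function.Injective f ∧ fwdCount Adj f = k}
  have hne : S.Nonempty :=
    ⟨_, (fun v => (Fintype.equivFin V v : ℕ)), by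
      intro a b h
      exact (Fintype.equivFin V).injective (Fin.ext h), rfl⟩
  have hbd : BddAbove S := by
    refine ⟨Fintype.card (V × V), ?_⟩
    rintro k ⟨f, -, rfl⟩
    exact Finset.card_le_univ _
  obtain ⟨f, hf, hfe⟩ := Nat.sSup_mem hne hbd
  refine ⟨f, hf, fun f' hf' => ?_⟩
  rw [hfe]
  exact le_csSup hbd ⟨f', hf', rfl⟩

theorem exists_medOrder [Fintype V] (Adj : V → V → Prop) :
    ∃ pos : V → ℕ, MedOrder Adj pos := by
  obtain ⟨f, hf, hmax⟩ := exists_max_fwd Adj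
  let pos : V → ℕ := fun v => (Finset.univ.filter (fun w => f w < f v)).card
  have hlt : ∀ a b, f a < f b → pos a < pos b := by
    intro a b hab
    apply Finset.card_lt_card
    refine ⟨fun w hw => ?_, fun h => ?_⟩
    · simp only [Finset.mem_filter, Finset.mem_univ, true_and] at hw ⊢
      omega
    · have := h (show a ∈ _ by simpa using hab)
      simp at this
  have hiff : ∀ a b, pos a < pos b ↔ f a < f b := by
    intro a b
    refine ⟨fun h => ?_, hlt a b⟩
    by_contra hc
    rcases Nat.lt_or_ge (f b) (f a) with h1 | h1
    · have := hlt b a h1; omega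
    · have : a = b := hf (by omega)
      subst this; omega
  have hinj : Function.Injective pos := by
    intro a b h
    by_contra hne
    have : f a ≠ f b := fun h' => hne (hf h')
    rcases Nat.lt_or_gt_of_ne this with h1 | h1
    · have := hlt a b h1; omega
    · have := hlt b a h1; omega
  have hposlt : ∀ v, pos v < Fintype.card V := by
    intro v
    apply Finset.card_lt_univ_of_notMem (x := v)
    simp
  refine ⟨pos, hinj, hposlt, ?_, ?_⟩
  · have him : Finset.univ.image pos = Finset.range (Fintype.card V) := by
      apply Finset.eq_of_subset_of_card_le
      · intro p hp
        obtain ⟨v, -, rfl⟩ := Finset.mem_image.1 hp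
        exact Finset.mem_range.2 (hposlt v)
      · rw [Finset.card_image_of_injective _ hinj]; simp
    intro p hp
    have : p ∈ Finset.univ.image pos := by rw [him]; exact Finset.mem_range.2 hp
    obtain ⟨v, -, hv⟩ := Finset.mem_image.1 this
    exact ⟨v, hv⟩
  · intro l
    let N := Fintype.card V
    let g : V → ℕ := fun v => l v * N + pos v
    have hg : ∀ a b, g a < g b ↔ (l a < l b ∨ (l a = l b ∧ pos a < pos b)) := by
      intro a b
      have ha := hposlt a
      have hb := hposlt b
      change l a * N + pos a < l b * N + pos b ↔ _
      change pos a < N at ha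
      change pos b < N at hb
      rcases lt_trichotomy (l a) (l b) with h | h | h
      · have : (l a + 1) * N ≤ l b * N := Nat.mul_le_mul_right _ h
        have : (l a + 1) * N = l a * N + N := by ring
        constructor
        · intro _; left; exact h
        · intro _; omega
      · rw [h]; constructor
        · intro h'; right; exact ⟨rfl, by omega⟩
        · rintro (h' | h')
          · omega
          · omega
      · have : (l b + 1) * N ≤ l a * N := Nat.mul_le_mul_right _ h
        have : (l b + 1) * N = l b * N + N := by ring
        constructor
        · intro _; omega
        · intro _; omega
    have hginj : Function.Injective g := by
      intro a b hab
      by_contra hne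
      have h1 : ¬ g a < g b := by omega
      have h2 : ¬ g b < g a := by omega
      rw [hg] at h1 h2
      have : pos a ≠ pos b := fun h => hne (hinj h)
      omega
    have hle := hmax g hginj
    have hA : ∀ (h h' : V → ℕ), Function.Injective h' → fwdCount Adj h =
        (Finset.univ.filter (fun p : V × V => Adj p.1 p.2 ∧ h p.1 < h p.2 ∧ h' p.1 < h' p.2)).card +
        (Finset.univ.filter (fun p : V × V => Adj p.1 p.2 ∧ h p.1 < h p.2 ∧ h' p.2 < h' p.1)).card := by
      intro h h' hh'
      rw [fwdCount, ← Finset.card_union_of_disjoint]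
      · congr 1
        ext ⟨a, b⟩
        simp only [Finset.mem_filter, Finset.mem_univ, true_and, Finset.mem_union]
        constructor
        · rintro ⟨h1, h2⟩
          have : h' a ≠ h' b := by
            intro h3
            have := hh' h3
            subst this; omega
          rcases Nat.lt_or_gt_of_ne this with h4 | h4
          · left; exact ⟨h1, h2, h4⟩
          · right; exact ⟨h1, h2, h4⟩
        · rintro (⟨h1, h2, -⟩ | ⟨h1, h2, -⟩) <;> exact ⟨h1, h2⟩
      · rw [Finset.disjoint_left]
        rintro ⟨a, b⟩ h1 h2
        simp only [Finset.mem_filter, Finset.mem_univ, true_and] at h1 h2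
        omega
    rw [hA g pos hinj, hA f g hginj] at hle
    have e1 : (Finset.univ.filter (fun p : V × V => Adj p.1 p.2 ∧ g p.1 < g p.2 ∧ pos p.1 < pos p.2))
        = (Finset.univ.filter (fun p : V × V => Adj p.1 p.2 ∧ f p.1 < f p.2 ∧ g p.1 < g p.2)) := by
      ext ⟨a, b⟩
      simp only [Finset.mem_filter, Finset.mem_univ, true_and, hiff]
      tauto
    have e2 : (Finset.univ.filter (fun p : V × V => Adj p.1 p.2 ∧ f p.1 < f p.2 ∧ g p.2 < g p.1))
        = (Finset.univ.filter (fun p : V × V => pos p.1 < pos p.2 ∧ l p.2 < l p.1 ∧ Adj p.1 p.2)) := by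
      ext ⟨a, b⟩
      simp only [Finset.mem_filter, Finset.mem_univ, true_and, ← hiff, hg]
      constructor
      · rintro ⟨h1, h2, h3⟩
        exact ⟨h2, by omega, h1⟩
      · rintro ⟨h1, h2, h3⟩
        exact ⟨h3, h1, by omega⟩
    have e3 : (Finset.univ.filter (fun p : V × V => Adj p.1 p.2 ∧ g p.1 < g p.2 ∧ pos p.2 < pos p.1)).card
        = (Finset.univ.filter (fun p : V × V => pos p.1 < pos p.2 ∧ l p.2 < l p.1 ∧ Adj p.2 p.1)).card := by
      apply Finset.card_bij (fun p _ => (p.2, p.1))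
      · rintro ⟨a, b⟩ h
        simp only [Finset.mem_filter, Finset.mem_univ, true_and, hg] at h ⊢
        exact ⟨h.2.2, by omega, h.1⟩
      · rintro ⟨a, b⟩ _ ⟨c, d⟩ _ h
        simp only [Prod.mk.injEq] at h ⊢
        exact ⟨h.2, h.1⟩
      · rintro ⟨a, b⟩ h
        refine ⟨(b, a), ?_, rfl⟩
        simp only [Finset.mem_filter, Finset.mem_univ, true_and, hg] at h ⊢
        exact ⟨h.2.2, by omega, h.1⟩
    rw [e1, e2, e3] at hle
    omega

/-- Number of vertices in an interval of positions. -/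
theorem card_interval [Fintype V] {Adj : V → V → Prop} {pos : V → ℕ} (hm : MedOrder Adj pos)
    (i j : ℕ) (hj : j ≤ Fintype.card V) :
    (Finset.univ.filter (fun w => i ≤ pos w ∧ pos w < j)).card = j - i := by
  rw [← Nat.card_Ico, ← Finset.card_image_of_injective _ hm.inj]
  congr 1
  ext p
  simp only [Finset.mem_image, Finset.mem_filter, Finset.mem_univ, true_and, Finset.mem_Ico]
  constructor
  · rintro ⟨a, h, rfl⟩; exact h
  · intro h
    obtain ⟨v, rfl⟩ := hm.surj p (by omega)
    exact ⟨v, h, rfl⟩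

theorem half_in [Fintype V] {Adj : V → V → Prop} (hT : IsTournament Adj)
    {pos : V → ℕ} (hm : MedOrder Adj pos) (v : V) (i : ℕ) :
    pos v - i ≤ 2 * (Finset.univ.filter (fun w => i ≤ pos w ∧ pos w < pos v ∧ Adj w v)).card := by
  have hs := hm.star (fun w => if pos w < i then 0 else if pos w < pos v then 2 else
    if pos w = pos v then 1 else 3)
  have key : ∀ a b : V, (pos a < pos b ∧
      (if pos b < i then 0 else if pos b < pos v then 2 else if pos b = pos v then 1 else 3) <
      (if pos a < i then 0 else if pos a < pos v then 2 else if pos a = pos v then 1 else 3)) ↔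
      (b = v ∧ i ≤ pos a ∧ pos a < pos v) := by
    intro a b
    have : b = v ↔ pos b = pos v := ⟨fun h => by rw [h], fun h => hm.inj h⟩
    rw [this]
    split_ifs <;> omega
  have h1 : (Finset.univ.filter (fun w => i ≤ pos w ∧ pos w < pos v ∧ Adj v w)).card ≤
      (Finset.univ.filter (fun w => i ≤ pos w ∧ pos w < pos v ∧ Adj w v)).card := by
    refine le_trans ?_ (le_trans hs ?_)
    · apply Finset.card_le_card_of_injOn (fun w => (w, v))
      · intro w hw
        simp only [Finset.coe_filter, Finset.mem_univ, true_and, Set.mem_ofPred_eq] at hw ⊢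
        have := (key w v).2 ⟨rfl, hw.1, hw.2.1⟩
        exact ⟨this.1, by simpa using this.2, hw.2.2⟩
      · intro a _ b _ h
        simpa using h
    · apply Finset.card_le_card_of_injOn (fun p => p.1)
      · rintro ⟨a, b⟩ hw
        simp only [Finset.coe_filter, Finset.mem_univ, true_and, Set.mem_ofPred_eq] at hw ⊢
        obtain ⟨rfl, h2, h3⟩ := (key a b).1 ⟨hw.1, hw.2.1⟩
        exact ⟨h2, h3, hw.2.2⟩
      · rintro ⟨a, b⟩ h1 ⟨c, d⟩ h2 h
        simp only [Finset.coe_filter, Finset.mem_univ, true_and, Set.mem_ofPred_eq] at h1 h2 h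
        have e1 := ((key a b).1 ⟨h1.1, h1.2.1⟩).1
        have e2 := ((key c d).1 ⟨h2.1, h2.2.1⟩).1
        rw [e1, e2, h]
  have h2 := card_interval hm i (pos v) (hm.lt v).le
  have h3 : (Finset.univ.filter (fun w => i ≤ pos w ∧ pos w < pos v)) ⊆
      (Finset.univ.filter (fun w => i ≤ pos w ∧ pos w < pos v ∧ Adj v w)) ∪
      (Finset.univ.filter (fun w => i ≤ pos w ∧ pos w < pos v ∧ Adj w v)) := by
    intro w hw
    simp only [Finset.mem_filter, Finset.mem_univ, true_and, Finset.mem_union] at hw ⊢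
    have hne : w ≠ v := by rintro rfl; omega
    have := hT.2 w v hne
    tauto
  have h4 := Finset.card_le_card h3
  have h5 := Finset.card_union_le
    (Finset.univ.filter (fun w => i ≤ pos w ∧ pos w < pos v ∧ Adj v w))
    (Finset.univ.filter (fun w => i ≤ pos w ∧ pos w < pos v ∧ Adj w v))
  omega

theorem half_out [Fintype V] {Adj : V → V → Prop} (hT : IsTournament Adj)
    {pos : V → ℕ} (hm : MedOrder Adj pos) (u : V) (j : ℕ) (hj : j < Fintype.card V) :
    j - pos u ≤ 2 * (Finset.univ.filter (fun w => pos u < pos w ∧ pos w ≤ j ∧ Adj u w)).card := by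
  have hs := hm.star (fun w => if pos w < pos u then 0 else if pos w = pos u then 2 else
    if pos w ≤ j then 1 else 3)
  have key : ∀ a b : V, (pos a < pos b ∧
      (if pos b < pos u then 0 else if pos b = pos u then 2 else if pos b ≤ j then 1 else 3) <
      (if pos a < pos u then 0 else if pos a = pos u then 2 else if pos a ≤ j then 1 else 3)) ↔
      (a = u ∧ pos u < pos b ∧ pos b ≤ j) := by
    intro a b
    have : a = u ↔ pos a = pos u := ⟨fun h => by rw [h], fun h => hm.inj h⟩
    rw [this]
    split_ifs <;> omega
  have h1 : (Finset.univ.filter (fun w => pos u < pos w ∧ pos w ≤ j ∧ Adj w u)).card ≤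
      (Finset.univ.filter (fun w => pos u < pos w ∧ pos w ≤ j ∧ Adj u w)).card := by
    refine le_trans ?_ (le_trans hs ?_)
    · apply Finset.card_le_card_of_injOn (fun w => (u, w))
      · intro w hw
        simp only [Finset.coe_filter, Finset.mem_univ, true_and, Set.mem_ofPred_eq] at hw ⊢
        have := (key u w).2 ⟨rfl, hw.1, hw.2.1⟩
        exact ⟨this.1, by simpa using this.2, hw.2.2⟩
      · intro a _ b _ h
        simpa using h
    · apply Finset.card_le_card_of_injOn (fun p => p.2)
      · rintro ⟨a, b⟩ hw
        simp only [Finset.coe_filter, Finset.mem_univ, true_and, Set.mem_ofPred_eq] at hw ⊢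
        obtain ⟨rfl, h2, h3⟩ := (key a b).1 ⟨hw.1, hw.2.1⟩
        exact ⟨h2, h3, hw.2.2⟩
      · rintro ⟨a, b⟩ h1 ⟨c, d⟩ h2 h
        simp only [Finset.coe_filter, Finset.mem_univ, true_and, Set.mem_ofPred_eq] at h1 h2 h
        have e1 := ((key a b).1 ⟨h1.1, h1.2.1⟩).1
        have e2 := ((key c d).1 ⟨h2.1, h2.2.1⟩).1
        rw [e1, e2, h]
  have h2 := card_interval hm (pos u + 1) (j + 1) hj
  have h3 : (Finset.univ.filter (fun w => pos u + 1 ≤ pos w ∧ pos w < j + 1)) ⊆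
      (Finset.univ.filter (fun w => pos u < pos w ∧ pos w ≤ j ∧ Adj w u)) ∪
      (Finset.univ.filter (fun w => pos u < pos w ∧ pos w ≤ j ∧ Adj u w)) := by
    intro w hw
    simp only [Finset.mem_filter, Finset.mem_univ, true_and, Finset.mem_union] at hw ⊢
    have hne : w ≠ u := by rintro rfl; omega
    have := hT.2 w u hne
    have h6 : pos w ≤ j := by omega
    have h7 : pos u < pos w := by omega
    tauto
  have h4 := Finset.card_le_card h3
  have h5 := Finset.card_union_le
    (Finset.univ.filter (fun w => pos u < pos w ∧ pos w ≤ j ∧ Adj w u))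
    (Finset.univ.filter (fun w => pos u < pos w ∧ pos w ≤ j ∧ Adj u w))
  omega

/-- `w` is reachable from `u` by a short walk inside `A`. -/
def Reach (Adj : V → V → Prop) (A : Finset V) (u : V) (t : ℕ) (w : V) : Prop :=
  ∃ P : Finset V, P.card ≤ t + 1 ∧ P ⊆ A ∧ u ∈ P ∧ w ∈ P ∧
    ∀ p ∈ P, Relation.ReflTransGen (RelOn Adj (P : Set V)) u p ∧
      Relation.ReflTransGen (RelOn Adj (P : Set V)) p w

theorem reach_zero {Adj : V → V → Prop} {A : Finset V} {u : V} (hu : u ∈ A) :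
    Reach Adj A u 0 u := by
  refine ⟨{u}, by simp, by simpa using hu, by simp, by simp, ?_⟩
  intro p hp
  rw [Finset.mem_singleton] at hp
  subst hp
  exact ⟨Relation.ReflTransGen.refl, Relation.ReflTransGen.refl⟩

theorem reach_succ {Adj : V → V → Prop} {A : Finset V} {u : V} {t : ℕ} {w : V}
    (h : Reach Adj A u t w) : Reach Adj A u (t + 1) w := by
  obtain ⟨P, h1, h2⟩ := h
  exact ⟨P, by omega, h2⟩

theorem reach_mono {Adj : V → V → Prop} {A : Finset V} {u : V} {t t' : ℕ} {w : V}
    (htt : t ≤ t') (h : Reach Adj A u t w) : Reach Adj A u t' w := by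
  obtain ⟨P, h1, h2⟩ := h
  exact ⟨P, by omega, h2⟩

theorem reach_mem {Adj : V → V → Prop} {A : Finset V} {u : V} {t : ℕ} {w : V}
    (h : Reach Adj A u t w) : w ∈ A := by
  obtain ⟨P, h1, h2, h3, h4, h5⟩ := h
  exact h2 h4

theorem reach_step {Adj : V → V → Prop} {A : Finset V} {u : V} {t : ℕ} {a w : V}
    (h : Reach Adj A u t a) (hw : w ∈ A) (haw : Adj a w) : Reach Adj A u (t + 1) w := by
  obtain ⟨P, h1, h2, h3, h4, h5⟩ := h
  have hsub : (P : Set V) ⊆ ((insert w P : Finset V) : Set V) := by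
    intro x hx; simp at hx ⊢; tauto
  have hstep : Relation.ReflTransGen (RelOn Adj ((insert w P : Finset V) : Set V)) a w :=
    Relation.ReflTransGen.single ⟨by simp [h4], by simp, haw⟩
  refine ⟨insert w P, ?_, ?_, by simp [h3], by simp, ?_⟩
  · have := Finset.card_insert_le w P; omega
  · intro x hx
    rcases Finset.mem_insert.1 hx with rfl | hx
    · exact hw
    · exact h2 hx
  · intro p hp
    rcases Finset.mem_insert.1 hp with rfl | hp
    · exact ⟨(relOn_mono hsub (h5 a h4).1).trans hstep, Relation.ReflTransGen.refl⟩
    · exact ⟨relOn_mono hsub (h5 p hp).1, (relOn_mono hsub (h5 p hp).2).trans hstep⟩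

theorem link [Fintype V] {Adj : V → V → Prop} (hT : IsTournament Adj)
    {pos : V → ℕ} (hm : MedOrder Adj pos) (U : Finset V) (u v : V)
    (hu : u ∉ U) (hv : v ∉ U) (g : ℕ) (hg : pos u + g = pos v) (hg1 : 1000 ≤ g)
    (hU : 128 * U.card ≤ g) : Reach Adj (Finset.univ \ U) u 130 v := by
  let I : Finset V := Finset.univ.filter (fun w => pos u ≤ pos w ∧ pos w < pos v + 1)
  let A : Finset V := I \ U
  have hIcard : I.card = g + 1 := by
    have := card_interval hm (pos u) (pos v + 1) (hm.lt v)
    change I.card = _ at this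
    omega
  suffices h : Reach Adj A u 130 v by
    obtain ⟨P, h1, h2, h3⟩ := h
    exact ⟨P, h1, h2.trans (Finset.sdiff_subset_sdiff (Finset.subset_univ _) le_rfl), h3⟩
  by_contra hcon
  have huA : u ∈ A := by simp [A, I, hu]; omega
  have hvA : v ∈ A := by simp [A, I, hv]; omega
  let R : ℕ → Finset V := fun t => Finset.univ.filter (fun w => Reach Adj A u t w)
  have hR : ∀ t w, w ∈ R t ↔ Reach Adj A u t w := by intro t w; simp [R]
  have hRI : ∀ t, R t ⊆ I := by
    intro t w hw
    exact (Finset.mem_sdiff.1 (reach_mem ((hR t w).1 hw))).1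
  have hRs : ∀ t, R t ⊆ R (t + 1) := by
    intro t w hw
    rw [hR] at hw ⊢
    exact reach_succ hw
  obtain ⟨t, ht1, ht2, ht3⟩ : ∃ t, 1 ≤ t ∧ t < 130 ∧ 128 * (R (t + 1) \ R t).card ≤ g := by
    by_contra hno
    push Not at hno
    have hind : ∀ t, t < 130 → t * (g + 1) ≤ 128 * (R (t + 1)).card := by
      intro t
      induction t with
      | zero => intro _; simp
      | succ k ih =>
        intro hk
        have h1 := ih (by omega)
        have h2 := hno (k + 1) (by omega) hk
        have h3 := Finset.card_sdiff_add_card_eq_card (hRs (k + 1))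
        have h4 : (k + 1) * (g + 1) = k * (g + 1) + (g + 1) := by ring
        omega
    have h1 := hind 129 (by omega)
    have h2 := Finset.card_le_card (hRI (129 + 1))
    omega
  let L : Finset V := R (t + 1) \ R t
  let U' : Finset V := U ∪ L
  have hU' : 64 * U'.card ≤ g := by
    have := Finset.card_union_le U L
    change U'.card ≤ _ at this
    change 128 * L.card ≤ g at ht3
    omega
  have hUU' : U.card ≤ U'.card := Finset.card_le_card Finset.subset_union_left
  have hvR : v ∉ R (t + 1) := by
    rw [hR]
    intro h
    exact hcon (reach_mono (by omega) h)
  have hnoedge : ∀ a b, a ∈ R t → b ∈ I → b ∉ R t → b ∉ U' → ¬ Adj a b := by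
    intro a b ha hb hbR hbU hab
    have hbU1 : b ∉ U := fun h => hbU (Finset.mem_union_left _ h)
    have h1 : b ∈ R (t + 1) := (hR _ _).2
      (reach_step ((hR _ _).1 ha) (Finset.mem_sdiff.2 ⟨hb, hbU1⟩) hab)
    exact hbU (Finset.mem_union_right _ (Finset.mem_sdiff.2 ⟨h1, hbR⟩))
  obtain ⟨h, hh1, hh2⟩ : ∃ h, 2 * h ≤ g ∧ g ≤ 2 * h + 1 := ⟨g / 2, by omega, by omega⟩
  let R' : Finset V := Finset.univ.filter (fun w => w ∈ R t ∧ pos u < pos w ∧ pos w ≤ pos u + h)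
  let Q' : Finset V := Finset.univ.filter
    (fun w => w ∉ R t ∧ w ∉ U' ∧ pos u + h + 1 ≤ pos w ∧ pos w < pos v)
  have hR'card : h ≤ 2 * (R'.card + U'.card) := by
    have h1 := half_out hT hm u (pos u + h) (by have := hm.lt v; omega)
    have h2 : (Finset.univ.filter (fun w => pos u < pos w ∧ pos w ≤ pos u + h ∧ Adj u w)) ⊆
        R' ∪ U' := by
      intro w hw
      simp only [Finset.mem_filter, Finset.mem_univ, true_and] at hw
      by_cases hwU : w ∈ U
      · exact Finset.mem_union_right _ (Finset.mem_union_left _ hwU)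
      · apply Finset.mem_union_left
        have hwA : w ∈ A := by
          simp only [A, I, Finset.mem_sdiff, Finset.mem_filter, Finset.mem_univ, true_and]
          exact ⟨by omega, hwU⟩
        have hr : w ∈ R t := (hR _ _).2
          (reach_mono (by omega) (reach_step (reach_zero huA) hwA hw.2.2))
        simp only [R', Finset.mem_filter, Finset.mem_univ, true_and]
        exact ⟨hr, hw.1, hw.2.1⟩
    have h3 := Finset.card_le_card h2
    have h4 := Finset.card_union_le R' U'
    omega
  have hQ'card : g - h - 1 ≤ 2 * (Q'.card + U'.card) := by
    have h1 := half_in hT hm v (pos u + h + 1)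
    have h2 : (Finset.univ.filter (fun w => pos u + h + 1 ≤ pos w ∧ pos w < pos v ∧ Adj w v)) ⊆
        Q' ∪ U' := by
      intro w hw
      simp only [Finset.mem_filter, Finset.mem_univ, true_and] at hw
      by_cases hwU : w ∈ U'
      · exact Finset.mem_union_right _ hwU
      · apply Finset.mem_union_left
        simp only [Q', Finset.mem_filter, Finset.mem_univ, true_and]
        refine ⟨fun hr => ?_, hwU, hw.1, hw.2.1⟩
        exact hvR ((hR _ _).2 (reach_step ((hR _ _).1 hr) hvA hw.2.2))
    have h3 := Finset.card_le_card h2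
    have h4 := Finset.card_union_le Q' U'
    omega
  obtain ⟨l, hl⟩ : ∃ l : V → ℕ, ∀ w, l w = if pos w < pos u then 0 else
      if pos v < pos w then 4 else if w ∈ R t then 3 else if w ∈ U' then 2 else 1 :=
    ⟨_, fun _ => rfl⟩
  have hs := hm.star l
  have hgain : R'.card * Q'.card ≤ (Finset.univ.filter
      (fun p : V × V => pos p.1 < pos p.2 ∧ l p.2 < l p.1 ∧ Adj p.2 p.1)).card := by
    rw [← Finset.card_product]
    apply Finset.card_le_card
    rintro ⟨a, b⟩ hab
    simp only [R', Q', Finset.mem_product, Finset.mem_filter, Finset.mem_univ, true_and] at hab ⊢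
    obtain ⟨⟨ha1, ha2, ha3⟩, hb1, hb2, hb3, hb4⟩ := hab
    have hla : l a = 3 := by
      rw [hl, if_neg (by omega), if_neg (by omega), if_pos ha1]
    have hlb : l b = 1 := by
      rw [hl, if_neg (by omega), if_neg (by omega), if_neg hb1, if_neg hb2]
    refine ⟨by omega, by omega, ?_⟩
    have hbI : b ∈ I := by
      simp only [I, Finset.mem_filter, Finset.mem_univ, true_and]; omega
    have hne : b ≠ a := by rintro rfl; omega
    have h1 := hnoedge a b ha1 hbI hb1 hb2
    exact (hT.2 b a hne).2 h1
  have hloss : (Finset.univ.filter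
      (fun p : V × V => pos p.1 < pos p.2 ∧ l p.2 < l p.1 ∧ Adj p.1 p.2)).card ≤
      2 * (U'.card * (g + 1)) := by
    have h1 : (Finset.univ.filter
      (fun p : V × V => pos p.1 < pos p.2 ∧ l p.2 < l p.1 ∧ Adj p.1 p.2)) ⊆
        (U' ×ˢ I) ∪ (I ×ˢ U') := by
      rintro ⟨a, b⟩ hab
      simp only [Finset.mem_product, Finset.mem_filter, Finset.mem_univ, true_and,
        Finset.mem_union] at hab ⊢
      obtain ⟨h1, h2, h3⟩ := hab
      have e1 := hl a
      have e2 := hl b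
      have hle4 : ∀ w, l w ≤ 4 := by
        intro w; rw [hl]; split_ifs <;> omega
      have := hle4 a
      have p1 : ¬ pos a < pos u := by
        intro h; rw [if_pos h] at e1; omega
      have p2 : ¬ pos v < pos b := by
        intro h; rw [if_neg (by omega), if_pos h] at e2; omega
      have haI : a ∈ I := by
        simp only [I, Finset.mem_filter, Finset.mem_univ, true_and]; omega
      have hbI : b ∈ I := by
        simp only [I, Finset.mem_filter, Finset.mem_univ, true_and]; omega
      rw [if_neg p1, if_neg (by omega)] at e1
      rw [if_neg (by omega), if_neg p2] at e2
      by_cases hbU : b ∈ U'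
      · exact Or.inr ⟨haI, hbU⟩
      by_cases haU : a ∈ U'
      · exact Or.inl ⟨haU, hbI⟩
      exfalso
      by_cases haR : a ∈ R t
      · by_cases hbR : b ∈ R t
        · rw [if_pos haR] at e1; rw [if_pos hbR] at e2; omega
        · exact hnoedge a b haR hbI hbR hbU h3
      · rw [if_neg haR, if_neg haU] at e1
        split_ifs at e2 <;> omega
    have h2 := Finset.card_le_card h1
    have h3 := Finset.card_union_le (U' ×ˢ I) (I ×ˢ U')
    rw [Finset.card_product, Finset.card_product, hIcard, Nat.mul_comm (g + 1)] at h3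
    omega
  have hfin := hgain.trans (hs.trans hloss)
  have hx : g ≤ 5 * R'.card := by omega
  have hy : g ≤ 5 * Q'.card := by omega
  have h1 : g * g ≤ (5 * R'.card) * (5 * Q'.card) := Nat.mul_le_mul hx hy
  have h2 : 64 * U'.card * (g + 1) ≤ g * (g + 1) := Nat.mul_le_mul_right _ hU'
  nlinarith

/-- Greedy choice of a small set hitting almost everything. -/
theorem greedy_cover {α β : Type} (rho : α → β → Prop) (F : Finset α) (Y : Finset β)
    (th : ℝ) (hF : F.Nonempty)
    (h : ∀ y ∈ Y, ((F.filter (fun x => ¬ rho x y)).card : ℝ) ≤ th * F.card) (hth : 0 ≤ th)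
    (s : ℕ) :
    ∃ S ⊆ F, S.card ≤ s ∧
      ((Y.filter (fun y => ∀ x ∈ S, ¬ rho x y)).card : ℝ) ≤ th ^ s * Y.card := by
  induction s with
  | zero => exact ⟨∅, by simp, by simp, by simp⟩
  | succ k ih =>
    obtain ⟨S, hSF, hSc, hS⟩ := ih
    set Z := Y.filter (fun y => ∀ x ∈ S, ¬ rho x y) with hZ
    have hdc : ∑ x ∈ F, ((Z.filter (fun y => ¬ rho x y)).card : ℝ) ≤ ∑ x ∈ F, th * Z.card := by
      have e1 : ∑ x ∈ F, (Z.filter (fun y => ¬ rho x y)).card =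
          ∑ y ∈ Z, (F.filter (fun x => ¬ rho x y)).card :=
        Finset.sum_card_bipartiteAbove_eq_sum_card_bipartiteBelow (fun x y => ¬ rho x y)
      have e2 : ∑ x ∈ F, ((Z.filter (fun y => ¬ rho x y)).card : ℝ) =
          ∑ y ∈ Z, ((F.filter (fun x => ¬ rho x y)).card : ℝ) := by exact_mod_cast e1
      rw [e2]
      calc ∑ y ∈ Z, ((F.filter (fun x => ¬ rho x y)).card : ℝ)
          ≤ ∑ y ∈ Z, th * F.card :=
            Finset.sum_le_sum (fun y hy => h y (Finset.mem_filter.1 hy).1)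
        _ = ∑ x ∈ F, th * Z.card := by
            simp only [Finset.sum_const, nsmul_eq_mul]; ring
    obtain ⟨x, hxF, hx⟩ := Finset.exists_le_of_sum_le hF hdc
    refine ⟨insert x S, ?_, ?_, ?_⟩
    · intro a ha
      rcases Finset.mem_insert.1 ha with rfl | ha
      · exact hxF
      · exact hSF ha
    · have := Finset.card_insert_le x S; omega
    · have hsub : Y.filter (fun y => ∀ z ∈ insert x S, ¬ rho z y) ⊆
          Z.filter (fun y => ¬ rho x y) := by
        intro y hy
        simp only [hZ, Finset.mem_filter, Finset.mem_insert, forall_eq_or_imp] at hy ⊢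
        tauto
      have h1 : ((Y.filter (fun y => ∀ z ∈ insert x S, ¬ rho z y)).card : ℝ) ≤
          (Z.filter (fun y => ¬ rho x y)).card := by exact_mod_cast Finset.card_le_card hsub
      calc _ ≤ _ := h1
        _ ≤ th * Z.card := hx
        _ ≤ th * (th ^ k * Y.card) := by gcongr
        _ = th ^ (k + 1) * Y.card := by ring

theorem greedy_disjoint (r c : ℕ) (Q : ℕ → Finset V → Prop)
    (h : ∀ i U, i < r → U.card ≤ r * c → ∃ P : Finset V, P.card ≤ c ∧ Disjoint P U ∧ Q i P) :
    ∃ P : ℕ → Finset V, (∀ i < r, (P i).card ≤ c ∧ Q i (P i)) ∧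
      ∀ i < r, ∀ j < r, i ≠ j → Disjoint (P i) (P j) := by
  have key : ∀ k ≤ r, ∃ P : ℕ → Finset V, (∀ i < k, (P i).card ≤ c ∧ Q i (P i)) ∧
      ∀ i < k, ∀ j < k, i ≠ j → Disjoint (P i) (P j) := by
    intro k
    induction k with
    | zero => intro _; exact ⟨fun _ => ∅, by simp, by simp⟩
    | succ k ih =>
      intro hk
      obtain ⟨P, hP1, hP2⟩ := ih (by omega)
      have hc : ((Finset.range k).biUnion P).card ≤ r * c := by
        refine (Finset.card_biUnion_le_card_mul _ _ c ?_).trans ?_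
        · intro i hi; exact (hP1 i (Finset.mem_range.1 hi)).1
        · rw [Finset.card_range]; exact Nat.mul_le_mul_right _ (by omega)
      obtain ⟨X, hX1, hX2, hX3⟩ := h k _ (by omega) hc
      have hXd : ∀ j < k, Disjoint X (P j) := by
        intro j hj
        refine hX2.mono_right ?_
        exact Finset.subset_biUnion_of_mem P (Finset.mem_range.2 hj)
      refine ⟨fun i => if i < k then P i else X, ?_, ?_⟩
      · intro i hi
        by_cases hik : i < k
        · simp only [hik, if_true]; exact hP1 i hik
        · have : i = k := by omega
          subst this
          simp only [lt_irrefl, if_false]; exact ⟨hX1, hX3⟩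
      · intro i hi j hj hij
        by_cases hik : i < k <;> by_cases hjk : j < k
        · simp only [hik, hjk, if_true]; exact hP2 i hik j hjk hij
        · simp only [hik, hjk, if_true, if_false]; exact (hXd i hik).symm
        · simp only [hik, hjk, if_true, if_false]; exact hXd j hjk
        · omega
  exact key r le_rfl

theorem exists_cores (Adj : V → V → Prop) (F B : Finset V) (b r s : ℕ)
    (hF : F.card ≤ 4 * b) (hB : B.card = b) (hb : 0 < b) (hrs : 2 * (r * s) ≤ b)
    (hdeg : ∀ y ∈ B, 3 * b ≤ 2 * (F.filter (fun x => Adj x y)).card)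
    (hnum : (2 * (3 / 4 : ℝ) ^ s) ^ s * r < 1) :
    ∃ S T : ℕ → Finset V,
      (∀ i < r, (S i).card ≤ s ∧ S i ⊆ F ∧ (T i).card ≤ s ∧ T i ⊆ B) ∧
      (∀ i < r, ∀ j < r, i ≠ j → Disjoint (S i) (S j) ∧ Disjoint (T i) (T j)) ∧
      (∀ i < r, ∀ j < r, ∃ x ∈ S i, ∃ y ∈ T j, Adj x y) := by
  obtain ⟨S, hS1, hS2⟩ := greedy_disjoint r s (fun _ P => P ⊆ F ∧
      ((B.filter (fun y => ∀ x ∈ P, ¬ Adj x y)).card : ℝ) ≤ (3 / 4) ^ s * B.card) (by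
    intro i U hi hU
    have hnb : ∀ y ∈ B, b ≤ ((F \ U).filter (fun x => Adj x y)).card := by
      intro y hy
      have h1 := hdeg y hy
      have h2 : F.filter (fun x => Adj x y) ⊆ (F \ U).filter (fun x => Adj x y) ∪ U := by
        intro x hx
        simp only [Finset.mem_union, Finset.mem_filter, Finset.mem_sdiff] at hx ⊢
        tauto
      have h3 := Finset.card_le_card h2
      have h4 := Finset.card_union_le ((F \ U).filter (fun x => Adj x y)) U
      omega
    have hFU : (F \ U).card ≤ 4 * b := (Finset.card_le_card Finset.sdiff_subset).trans hF
    have hne : (F \ U).Nonempty := by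
      obtain ⟨y, hy⟩ : B.Nonempty := Finset.card_pos.1 (by omega)
      have h1 := hnb y hy
      have : ((F \ U).filter (fun x => Adj x y)).Nonempty := Finset.card_pos.1 (by omega)
      exact this.mono (Finset.filter_subset _ _)
    obtain ⟨P, hP1, hP2, hP3⟩ := greedy_cover Adj (F \ U) B (3 / 4) hne (by
      intro y hy
      have h1 := hnb y hy
      have h2 := Finset.card_filter_add_card_filter_not (s := F \ U) (fun x => Adj x y)
      have h3 : 4 * ((F \ U).filter (fun x => ¬ Adj x y)).card ≤ 3 * (F \ U).card := by omega
      have h4 : (4 : ℝ) * ((F \ U).filter (fun x => ¬ Adj x y)).card ≤ 3 * (F \ U).card := by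
        exact_mod_cast h3
      linarith) (by norm_num) s
    refine ⟨P, hP2, ?_, hP1.trans Finset.sdiff_subset, hP3⟩
    exact Finset.disjoint_of_subset_left hP1 Finset.sdiff_disjoint)
  obtain ⟨T, hT1, hT2⟩ := greedy_disjoint r s (fun _ P => P ⊆ B ∧
      ∀ i < r, ∃ y ∈ P, ∃ x ∈ S i, Adj x y) (by
    intro j U hj hU
    have hBU : b ≤ 2 * (B \ U).card := by
      have h2 : B ⊆ (B \ U) ∪ U := by
        intro x hx
        simp only [Finset.mem_union, Finset.mem_sdiff]
        tauto
      have h3 := Finset.card_le_card h2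
      have h4 := Finset.card_union_le (B \ U) U
      omega
    have hne : (B \ U).Nonempty := Finset.card_pos.1 (by omega)
    obtain ⟨rho, hrho⟩ : ∃ rho : V → ℕ → Prop, ∀ y i, rho y i ↔ ∃ x ∈ S i, Adj x y :=
      ⟨_, fun _ _ => Iff.rfl⟩
    obtain ⟨P, hP1, hP2, hP3⟩ := greedy_cover rho (B \ U)
      (Finset.range r) (2 * (3 / 4) ^ s) hne (by
      intro i hi
      have h1 := (hS1 i (Finset.mem_range.1 hi)).2.2
      have h2 : (B \ U).filter (fun y => ¬ rho y i) ⊆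
          B.filter (fun y => ∀ x ∈ S i, ¬ Adj x y) := by
        intro y hy
        simp only [Finset.mem_filter, Finset.mem_sdiff, hrho, not_exists, not_and] at hy ⊢
        exact ⟨hy.1.1, hy.2⟩
      have h3 : (((B \ U).filter (fun y => ¬ rho y i)).card : ℝ) ≤
          (B.filter (fun y => ∀ x ∈ S i, ¬ Adj x y)).card := by
        exact_mod_cast Finset.card_le_card h2
      have h4 : (B.card : ℝ) ≤ 2 * (B \ U).card := by rw [hB]; exact_mod_cast hBU
      have h5 : (3 / 4 : ℝ) ^ s * B.card ≤ (3 / 4 : ℝ) ^ s * (2 * (B \ U).card) := by gcongr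
      linarith) (by positivity) s
    refine ⟨P, hP2, Finset.disjoint_of_subset_left hP1 Finset.sdiff_disjoint,
      hP1.trans Finset.sdiff_subset, ?_⟩
    intro i hi
    by_contra hcon
    have hmem : i ∈ (Finset.range r).filter (fun i => ∀ y ∈ P, ¬ rho y i) := by
      simp only [Finset.mem_filter, Finset.mem_range, hrho]
      refine ⟨hi, fun y hy hx => hcon ⟨y, hy, hx⟩⟩
    have hpos := Finset.card_pos.2 ⟨i, hmem⟩
    have hpos' : (1 : ℝ) ≤
      ((Finset.range r).filter (fun i => ∀ y ∈ P, ¬ rho y i)).card := by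
      exact_mod_cast hpos
    rw [Finset.card_range] at hP3
    linarith)
  refine ⟨S, T, ?_, ?_, ?_⟩
  · intro i hi
    exact ⟨(hS1 i hi).1, (hS1 i hi).2.1, (hT1 i hi).1, (hT1 i hi).2.1⟩
  · intro i hi j hj hij
    exact ⟨hS2 i hi j hj hij, hT2 i hi j hj hij⟩
  · intro i hi j hj
    obtain ⟨y, hy, x, hx, hxy⟩ := (hT1 j hj).2.2 i hi
    exact ⟨x, hx, y, hy, hxy⟩

/-- A nonempty finite tournament has a vertex reaching everything and one reached by everything. -/
theorem exists_ends {Adj : V → V → Prop} (hT : IsTournament Adj) (A : Finset V)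
    (hA : A.Nonempty) :
    ∃ x ∈ A, ∃ y ∈ A, ∀ w ∈ A, Relation.ReflTransGen (RelOn Adj (A : Set V)) x w ∧
      Relation.ReflTransGen (RelOn Adj (A : Set V)) w y := by
  induction hA using Finset.Nonempty.cons_induction with
  | singleton a =>
    refine ⟨a, by simp, a, by simp, ?_⟩
    intro w hw
    rw [Finset.mem_singleton] at hw
    subst hw
    exact ⟨Relation.ReflTransGen.refl, Relation.ReflTransGen.refl⟩
  | cons a A ha hA ih =>
    obtain ⟨x, hx, y, hy, h⟩ := ih
    rw [Finset.cons_eq_insert]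
    have hsub : (A : Set V) ⊆ ((insert a A : Finset V) : Set V) := by
      intro x hx; simp at hx ⊢; tauto
    have hax : a ≠ x := by rintro rfl; exact ha hx
    have hay : a ≠ y := by rintro rfl; exact ha hy
    have hX : ∃ x' ∈ insert a A, ∀ w ∈ insert a A,
        Relation.ReflTransGen (RelOn Adj ((insert a A : Finset V) : Set V)) x' w := by
      by_cases hadj : Adj a x
      · refine ⟨a, by simp, fun w hw => ?_⟩
        rcases Finset.mem_insert.1 hw with rfl | hw
        · exact Relation.ReflTransGen.refl
        · exact Relation.ReflTransGen.head ⟨by simp, by simp [hx], hadj⟩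
            (relOn_mono hsub (h w hw).1)
      · have hadj' : Adj x a := (hT.2 x a hax.symm).2 hadj
        refine ⟨x, by simp [hx], fun w hw => ?_⟩
        rcases Finset.mem_insert.1 hw with rfl | hw
        · exact Relation.ReflTransGen.single ⟨by simp [hx], by simp, hadj'⟩
        · exact relOn_mono hsub (h w hw).1
    have hY : ∃ y' ∈ insert a A, ∀ w ∈ insert a A,
        Relation.ReflTransGen (RelOn Adj ((insert a A : Finset V) : Set V)) w y' := by
      by_cases hadj : Adj y a
      · refine ⟨a, by simp, fun w hw => ?_⟩
        rcases Finset.mem_insert.1 hw with rfl | hw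
        · exact Relation.ReflTransGen.refl
        · exact Relation.ReflTransGen.tail (relOn_mono hsub (h w hw).2)
            ⟨by simp [hy], by simp, hadj⟩
      · have hadj' : Adj a y := (hT.2 a y hay).2 hadj
        refine ⟨y, by simp [hy], fun w hw => ?_⟩
        rcases Finset.mem_insert.1 hw with rfl | hw
        · exact Relation.ReflTransGen.single ⟨by simp, by simp [hy], hadj'⟩
        · exact relOn_mono hsub (h w hw).2
    obtain ⟨x', hx', hx2⟩ := hX
    obtain ⟨y', hy', hy2⟩ := hY
    exact ⟨x', hx', y', hy', fun w hw => ⟨hx2 w hw, hy2 w hw⟩⟩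

/-- Making a core strongly connected. -/
theorem connect [Fintype V] {Adj : V → V → Prop} (hT : IsTournament Adj)
    {pos : V → ℕ} (hm : MedOrder Adj pos) (b : ℕ) (hb : 1000 ≤ b) (hn : 8 * b ≤ Fintype.card V)
    (hd : ∀ v, 9 * b ≤ (Finset.univ.filter (fun w => Adj v w)).card)
    (A W : Finset V) (hA : A.Nonempty) (hW : 128 * (W.card + 131) ≤ b)
    (hAp : ∀ a ∈ A, Fintype.card V ≤ pos a + 7 * b ∧ pos a + 2 * b ≤ Fintype.card V) :
    ∃ P : Finset V, P.card ≤ 262 ∧ Disjoint P W ∧ StronglyConnectedOn Adj ((A ∪ P : Finset V) : Set V) := by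
  obtain ⟨x, hx, y, hy, hxy⟩ := exists_ends hT A hA
  -- the vertex at the end
  obtain ⟨e, he1, he2⟩ : ∃ e, Fintype.card V ≤ pos e + b ∧ e ∉ W := by
    by_contra hno
    push Not at hno
    have h1 := card_interval hm (Fintype.card V - b) (Fintype.card V) le_rfl
    have h2 : (Finset.univ.filter (fun w => Fintype.card V - b ≤ pos w ∧ pos w < Fintype.card V)) ⊆ W := by
      intro w hw
      simp only [Finset.mem_filter, Finset.mem_univ, true_and] at hw
      exact hno w (by omega)
    have h3 := Finset.card_le_card h2
    omega
  have hyp := hAp y hy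
  have hxp := hAp x hx
  have hcW : ∀ (W' : Finset V) (z : V), (W' \ {z}).card ≤ W'.card :=
    fun W' z => Finset.card_le_card Finset.sdiff_subset
  obtain ⟨P1, p1c, p1A, p1y, p1e, p1⟩ := link hT hm (W \ {y}) y e (by simp) (by simp [he2])
    (pos e - pos y) (by omega) (by omega) (by have := hcW W y; omega)
  obtain ⟨z, hz1, hz2, hz3⟩ : ∃ z, Adj e z ∧ pos z + 8 * b < Fintype.card V ∧ z ∉ W ∪ P1 := by
    by_contra hno
    push Not at hno
    have h1 := card_interval hm (Fintype.card V - 8 * b) (Fintype.card V) le_rfl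
    have h2 : (Finset.univ.filter (fun w => Adj e w)) ⊆ (Finset.univ.filter
        (fun w => Fintype.card V - 8 * b ≤ pos w ∧ pos w < Fintype.card V)) ∪ (W ∪ P1) := by
      intro w hw
      simp only [Finset.mem_filter, Finset.mem_univ, true_and] at hw
      by_cases hwp : pos w + 8 * b < Fintype.card V
      · exact Finset.mem_union_right _ (hno w hw hwp)
      · apply Finset.mem_union_left
        simp only [Finset.mem_filter, Finset.mem_univ, true_and]
        have := hm.lt w
        omega
    have h3 := Finset.card_le_card h2
    have h4 := Finset.card_union_le (Finset.univ.filter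
        (fun w => Fintype.card V - 8 * b ≤ pos w ∧ pos w < Fintype.card V)) (W ∪ P1)
    have h5 := Finset.card_union_le W P1
    have h6 := hd e
    omega
  obtain ⟨P2, p2c, p2A, p2z, p2x, p2⟩ := link hT hm ((W ∪ P1) \ {x}) z x
    (by intro h; exact hz3 (Finset.mem_sdiff.1 h).1) (by simp)
    (pos x - pos z) (by omega) (by omega) (by
      have := hcW (W ∪ P1) x
      have h5 := Finset.card_union_le W P1
      omega)
  have hX : A ∪ ((P1 ∪ P2) \ W) = A ∪ P1 ∪ P2 := by
    ext w
    simp only [Finset.mem_union, Finset.mem_sdiff]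
    constructor
    · tauto
    · rintro ((h | h) | h)
      · exact Or.inl h
      · by_cases hw : w ∈ W
        · left
          have := p1A h
          simp only [Finset.mem_sdiff, Finset.mem_univ, true_and, Finset.mem_singleton] at this
          have : w = y := by tauto
          exact this ▸ hy
        · exact Or.inr ⟨Or.inl h, hw⟩
      · by_cases hw : w ∈ W
        · left
          have := p2A h
          simp only [Finset.mem_sdiff, Finset.mem_univ, true_and, Finset.mem_singleton,
            Finset.mem_union] at this
          have : w = x := by tauto
          exact this ▸ hx
        · exact Or.inr ⟨Or.inr h, hw⟩
  refine ⟨(P1 ∪ P2) \ W, ?_, Finset.sdiff_disjoint, ?_⟩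
  · have h1 := Finset.card_le_card (Finset.sdiff_subset (s := P1 ∪ P2) (t := W))
    have h2 := Finset.card_union_le P1 P2
    omega
  · rw [hX]
    have sA : (A : Set V) ⊆ ((A ∪ P1 ∪ P2 : Finset V) : Set V) := by
      intro w hw; simp at hw ⊢; tauto
    have s1 : (P1 : Set V) ⊆ ((A ∪ P1 ∪ P2 : Finset V) : Set V) := by
      intro w hw; simp at hw ⊢; tauto
    have s2 : (P2 : Set V) ⊆ ((A ∪ P1 ∪ P2 : Finset V) : Set V) := by
      intro w hw; simp at hw ⊢; tauto
    have hxy' := relOn_mono sA (hxy y hy).1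
    have hye := relOn_mono s1 (p1 e p1e).1
    have hez : Relation.ReflTransGen (RelOn Adj ((A ∪ P1 ∪ P2 : Finset V) : Set V)) e z :=
      Relation.ReflTransGen.single ⟨s1 p1e, s2 p2z, hz1⟩
    have hzx := relOn_mono s2 (p2 x p2x).1
    have hub : ∀ w ∈ ((A ∪ P1 ∪ P2 : Finset V) : Set V),
        Relation.ReflTransGen (RelOn Adj ((A ∪ P1 ∪ P2 : Finset V) : Set V)) x w ∧
        Relation.ReflTransGen (RelOn Adj ((A ∪ P1 ∪ P2 : Finset V) : Set V)) w x := by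
      intro w hw
      rw [Finset.mem_coe, Finset.mem_union, Finset.mem_union] at hw
      rcases hw with (h | h) | h
      · have := hxy w h
        exact ⟨relOn_mono sA this.1,
          (((relOn_mono sA this.2).trans hye).trans hez).trans hzx⟩
      · have := p1 w h
        exact ⟨hxy'.trans (relOn_mono s1 this.1), ((relOn_mono s1 this.2).trans hez).trans hzx⟩
      · have := p2 w h
        exact ⟨((hxy'.trans hye).trans hez).trans (relOn_mono s2 this.1), relOn_mono s2 this.2⟩
    intro a ha c hc
    exact (hub a ha).2.trans (hub c hc).1

theorem main_nat [Fintype V] {Adj : V → V → Prop} (hT : IsTournament Adj) (r s b : ℕ)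
    (hr : 0 < r) (hs : 0 < s) (hb : b = 60000 * (r * s))
    (hd : ∀ v, 9 * b ≤ (Finset.univ.filter (fun w => Adj v w)).card) [Nonempty V]
    (hnum : (2 * (3 / 4 : ℝ) ^ s) ^ s * r < 1) :
    ContainsStrongCompleteMinor Adj r := by
  obtain ⟨pos, hm⟩ := exists_medOrder Adj
  have hrs : 0 < r * s := Nat.mul_pos hr hs
  have hrle : r ≤ r * s := Nat.le_mul_of_pos_right _ hs
  have hn : 9 * b ≤ Fintype.card V := (hd (Classical.arbitrary V)).trans (Finset.card_le_univ _)
  let p := Fintype.card V - 7 * b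
  let F : Finset V := Finset.univ.filter (fun w => p ≤ pos w ∧ pos w < p + 4 * b)
  let B : Finset V := Finset.univ.filter (fun w => p + 4 * b ≤ pos w ∧ pos w < p + 5 * b)
  have hp : p + 7 * b = Fintype.card V := by omega
  have hFc : F.card = 4 * b := by
    have := card_interval hm p (p + 4 * b) (by omega)
    change F.card = _ at this
    omega
  have hBc : B.card = b := by
    have := card_interval hm (p + 4 * b) (p + 5 * b) (by omega)
    change B.card = _ at this
    omega
  have hFm : ∀ w, w ∈ F ↔ p ≤ pos w ∧ pos w < p + 4 * b := by intro w; simp [F]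
  have hBm : ∀ w, w ∈ B ↔ p + 4 * b ≤ pos w ∧ pos w < p + 5 * b := by intro w; simp [B]
  obtain ⟨S, T, h1, h2, h3⟩ := exists_cores Adj F B b r s hFc.le hBc (by omega) (by omega) (by
    intro y hy
    rw [hBm] at hy
    have h1 := half_in hT hm y p
    have h2 := card_interval hm (p + 4 * b) (pos y) (hm.lt y).le
    have h3 : (Finset.univ.filter (fun w => p ≤ pos w ∧ pos w < pos y ∧ Adj w y)) ⊆
        F.filter (fun x => Adj x y) ∪
        (Finset.univ.filter (fun w => p + 4 * b ≤ pos w ∧ pos w < pos y)) := by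
      intro w hw
      simp only [Finset.mem_union, Finset.mem_filter, Finset.mem_univ, true_and, hFm] at hw ⊢
      by_cases h : pos w < p + 4 * b
      · exact Or.inl ⟨⟨hw.1, h⟩, hw.2.2⟩
      · exact Or.inr ⟨by omega, hw.2.1⟩
    have h4 := Finset.card_le_card h3
    have h5 := Finset.card_union_le (F.filter (fun x => Adj x y))
      (Finset.univ.filter (fun w => p + 4 * b ≤ pos w ∧ pos w < pos y))
    omega) hnum
  let A : ℕ → Finset V := fun i => S i ∪ T i
  let W : Finset V := (Finset.range r).biUnion A
  have hWc : W.card ≤ r * (2 * s) := by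
    have := Finset.card_biUnion_le_card_mul (Finset.range r) A (2 * s) (by
      intro i hi
      have hi' := h1 i (Finset.mem_range.1 hi)
      have := Finset.card_union_le (S i) (T i)
      change (S i ∪ T i).card ≤ _
      omega)
    rwa [Finset.card_range] at this
  have hAW : ∀ i < r, A i ⊆ W := fun i hi =>
    Finset.subset_biUnion_of_mem A (Finset.mem_range.2 hi)
  have hrs2 : r * (2 * s) = 2 * (r * s) := by ring
  have hApos : ∀ i < r, ∀ a ∈ A i, p ≤ pos a ∧ pos a < p + 5 * b := by
    intro i hi a ha
    rcases Finset.mem_union.1 ha with h | h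
    · have := (hFm a).1 ((h1 i hi).2.1 h); omega
    · have := (hBm a).1 ((h1 i hi).2.2.2 h); omega
  have hFB : Disjoint F B := by
    rw [Finset.disjoint_left]
    intro a ha hb'
    rw [hFm] at ha
    rw [hBm] at hb'
    omega
  have hAdisj : ∀ i < r, ∀ j < r, i ≠ j → Disjoint (A i) (A j) := by
    intro i hi j hj hij
    have a1 := h1 i hi
    have a2 := h1 j hj
    have a3 := h2 i hi j hj hij
    change Disjoint (S i ∪ T i) (S j ∪ T j)
    rw [Finset.disjoint_union_left, Finset.disjoint_union_right, Finset.disjoint_union_right]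
    exact ⟨⟨a3.1, hFB.mono a1.2.1 a2.2.2.2⟩, (hFB.mono a2.2.1 a1.2.2.2).symm, a3.2⟩
  obtain ⟨P, hP1, hP2⟩ := greedy_disjoint r 262 (fun i P => Disjoint P W ∧
      StronglyConnectedOn Adj ((A i ∪ P : Finset V) : Set V)) (by
    intro i U hi hU
    obtain ⟨x, hx, y, hy, -⟩ := h3 i hi i hi
    obtain ⟨P, hP, hPd, hPs⟩ := connect hT hm b (by omega) (by omega) hd (A i) (W ∪ U)
      ⟨x, Finset.mem_union_left _ hx⟩ (by
        have := Finset.card_union_le W U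
        omega) (by
        intro a ha
        have := hApos i hi a ha
        omega)
    rw [Finset.disjoint_union_right] at hPd
    exact ⟨P, hP, hPd.2, hPd.1, hPs⟩)
  refine ⟨fun i => ((A i ∪ P i : Finset V) : Set V), ?_, ?_, ?_, ?_⟩
  · intro i
    obtain ⟨x, hx, -⟩ := h3 i i.2 i i.2
    exact ⟨x, by simp [A, hx]⟩
  · intro i j hij
    have hij' : (i : ℕ) ≠ j := fun h => hij (Fin.ext h)
    rw [Finset.disjoint_coe]
    exact Finset.disjoint_union_left.2 ⟨Finset.disjoint_union_right.2
        ⟨hAdisj i i.2 j j.2 hij', ((hP1 j j.2).2.1.mono_right (hAW i i.2)).symm⟩,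
      Finset.disjoint_union_right.2
        ⟨(hP1 i i.2).2.1.mono_right (hAW j j.2), hP2 i i.2 j j.2 hij'⟩⟩
  · intro i
    exact (hP1 i i.2).2.2
  · intro i j hij
    obtain ⟨x, hx, y, hy, hxy⟩ := h3 i i.2 j j.2
    exact ⟨x, by simp [A, hx], y, by simp [A, hy], hxy⟩

theorem numeric (r : ℕ) (hr : 2 ≤ r) :
    ∃ s : ℕ, 0 < s ∧ (s : ℝ) ≤ 10 * Real.sqrt (Real.log r) ∧
      (2 * (3 / 4 : ℝ) ^ s) ^ s * r < 1 := by
  have hr' : (2 : ℝ) ≤ r := by exact_mod_cast hr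
  have hlog : 0.69 < Real.log r :=
    lt_of_lt_of_le (by have := Real.log_two_gt_d9; linarith) (Real.log_le_log (by norm_num) hr')
  set L := Real.log r with hL
  have hsq : Real.sqrt L ^ 2 = L := Real.sq_sqrt (by linarith)
  have hsq0 : 0.8 ≤ Real.sqrt L := Real.le_sqrt_of_sq_le (by norm_num; linarith)
  have hs1 := Nat.le_ceil (8 * Real.sqrt L)
  have hs2 := Nat.ceil_lt_add_one (a := 8 * Real.sqrt L) (by positivity)
  set s := ⌈8 * Real.sqrt L⌉₊ with hs
  refine ⟨s, ?_, by linarith, ?_⟩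
  · have : (0 : ℝ) < s := by linarith
    exact_mod_cast this
  · have h34 : (3 / 4 : ℝ) ≤ Real.exp (-(1 / 4)) := by
      have := Real.add_one_le_exp (-(1 / 4) : ℝ); linarith
    have h2 : (2 : ℝ) ≤ Real.exp 0.7 := by
      rw [← Real.exp_log (show (0 : ℝ) < 2 by norm_num)]
      apply Real.exp_le_exp.2
      have := Real.log_two_lt_d9; linarith
    have h3 : 2 * (3 / 4 : ℝ) ^ s ≤ Real.exp (-(s / 8)) := by
      calc 2 * (3 / 4 : ℝ) ^ s ≤ Real.exp 0.7 * (Real.exp (-(1 / 4))) ^ s := by gcongr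
        _ = Real.exp (0.7 + s * (-(1 / 4))) := by rw [← Real.exp_nat_mul, ← Real.exp_add]
        _ ≤ _ := Real.exp_le_exp.2 (by linarith)
    have hrexp : (r : ℝ) = Real.exp L := by rw [hL, Real.exp_log (by linarith)]
    calc (2 * (3 / 4 : ℝ) ^ s) ^ s * r ≤ (Real.exp (-(s / 8))) ^ s * Real.exp L := by
          rw [← hrexp]; gcongr
      _ = Real.exp (s * (-(s / 8)) + L) := by rw [← Real.exp_nat_mul, ← Real.exp_add]
      _ < 1 := by
          rw [Real.exp_lt_one_iff]
          nlinarith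

theorem outDeg_eq [Fintype V] (Adj : V → V → Prop) (v : V) :
    outDeg Adj v = (Finset.univ.filter (fun w => Adj v w)).card := by
  rw [outDeg, ← Set.ncard_coe_finset]
  congr 1
  ext w
  simp

end Helpers

/-- there is a constant `C > 0` such that every tournament with
minimum out-degree at least `C * r * √(log r)` contains a strong `K⃗ r`
minor. -/
theorem tournament_min_outdegree_strong_minor :
    ∃ C : ℝ, 0 < C ∧
      ∀ (r : ℕ), 0 < r →
        ∀ (V : Type) [Fintype V] [Nonempty V] (Adj : V → V → Prop),
          IsTournament Adj →
          (∀ v : V, C * r * Real.sqrt (Real.log r) ≤ (outDeg Adj v : ℝ)) →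
          ContainsStrongCompleteMinor Adj r := by
  refine ⟨5400000, by norm_num, ?_⟩
  intro r hr V _ _ Adj hT hdeg
  by_cases hr1 : r = 1
  · subst hr1
    refine ⟨fun _ => {Classical.arbitrary V}, fun _ => Set.singleton_nonempty _, ?_, ?_, ?_⟩
    · intro i j hij
      exact absurd (Subsingleton.elim i j) hij
    · intro i u hu v hv
      rw [Set.mem_singleton_iff] at hu hv
      rw [hu, hv]
    · intro i j hij
      exact absurd (Subsingleton.elim i j) hij
  · obtain ⟨s, hs0, hs1, hs2⟩ := numeric r (by omega)
    classical
    refine main_nat hT r s _ hr hs0 rfl ?_ hs2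
    intro v
    have h1 := hdeg v
    rw [outDeg_eq] at h1
    have h2 : ((9 * (60000 * (r * s)) : ℕ) : ℝ) ≤ 5400000 * r * Real.sqrt (Real.log r) := by
      push_cast
      have : (r : ℝ) * s ≤ r * (10 * Real.sqrt (Real.log r)) := by gcongr
      linarith
    have h3 := h2.trans h1
    have h4 := Nat.cast_le.1 h3
    convert h4
end

section
/- There is no function f : ℕ → ℕ such that every digraph D with δ⁺(D) ≥ f(r) satisfies sm(D) ≥ r. Equivalently, for every function f : ℕ → ℕ there exist an integer r and a digraph D with δ⁺(D) ≥ f(r) that contains no strong K⃗_r minor. -/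
/-- Tree edges from a vertex to its children, and edges from the leaves (depth `d`) to all
proper ancestors.  Vertices of the tree are lists; the ancestors of a list are its suffixes. -/
def TreeAdj (d : ℕ) (u v : List (Fin d)) : Prop :=
  (∃ a, v = a :: u) ∨ (u.length = d ∧ v <:+ u ∧ v ≠ u)

theorem top_suffix {W : Type} {d : ℕ} (g : W → List (Fin d)) (X : Set W)
    (hX : StronglyConnectedOn (fun a b => TreeAdj d (g a) (g b)) X)
    (t : W) (ht : t ∈ X) (hmin : ∀ x ∈ X, (g t).length ≤ (g x).length) :
    ∀ x ∈ X, g t <:+ g x := by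
  intro x hx
  have h := hX ht hx
  clear hx
  induction h with
  | refl => exact List.suffix_refl _
  | tail _ hbc ih =>
    obtain ⟨_, hc, h | h⟩ := hbc
    · obtain ⟨a, ha⟩ := h
      rw [ha]
      exact ih.trans (List.suffix_cons _ _)
    · exact List.suffix_of_suffix_length_le ih h.2.1 (hmin _ hc)

theorem parent_mem {W : Type} {d : ℕ} (g : W → List (Fin d)) (hg : Function.Injective g)
    (X Y : Set W) (hXY : Disjoint X Y)
    (hX : StronglyConnectedOn (fun a b => TreeAdj d (g a) (g b)) X)
    (s t : W) (hs : s ∈ X) (ht : t ∈ Y) (hY : ∀ y ∈ Y, g t <:+ g y)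
    (hle : (g s).length ≤ (g t).length)
    (hE : ∃ u ∈ X, ∃ v ∈ Y, TreeAdj d (g u) (g v)) :
    ∃ p ∈ X, ∃ c, g t = c :: g p := by
  have hne : ∀ x ∈ X, g t ≠ g x := by
    intro x hx h
    exact Set.disjoint_left.mp hXY hx (hg h ▸ ht)
  obtain ⟨u, hu, v, hv, huv⟩ := hE
  have hout : ¬ (g t <:+ g u) := by
    have h := hX hs hu
    clear huv hu
    induction h with
    | refl => exact fun h => hne s hs (h.eq_of_length_le hle)
    | tail _ hbc ih =>
      obtain ⟨_, hc, h | h⟩ := hbc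
      · obtain ⟨a, ha⟩ := h
        intro h2
        rw [ha, List.suffix_cons_iff] at h2
        rcases h2 with h2 | h2
        · exact hne _ hc (h2.trans ha.symm)
        · exact ih h2
      · exact fun h2 => ih (h2.trans h.2.1)
  rcases huv with ⟨a, ha⟩ | h
  · have h2 := hY v hv
    rw [ha, List.suffix_cons_iff] at h2
    rcases h2 with h2 | h2
    · exact ⟨u, hu, a, h2⟩
    · exact absurd h2 hout
  · exact absurd ((hY v hv).trans h.2.1) hout

theorem no_minor {W : Type} {d : ℕ} (g : W → List (Fin d)) (hg : Function.Injective g) :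
    ¬ ContainsStrongCompleteMinor (fun a b => TreeAdj d (g a) (g b)) 3 := by
  rintro ⟨X, hne, hdis, hsc, hE⟩
  have htop : ∀ i, ∃ t ∈ X i, ∀ x ∈ X i, (g t).length ≤ (g x).length := by
    intro i
    obtain ⟨t, ht, h⟩ := WellFounded.has_min (measure (fun w => (g w).length)).wf (X i) (hne i)
    exact ⟨t, ht, fun x hx => not_lt.mp (h x hx)⟩
  choose t ht hmin using htop
  obtain ⟨j, hj⟩ := Finite.exists_max (fun i => (g (t i)).length)
  have key : ∀ i, i ≠ j → ∃ p ∈ X i, ∃ c, g (t j) = c :: g p := fun i hij =>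
    parent_mem g hg (X i) (X j) (hdis i j hij) (hsc i) (t i) (t j) (ht i) (ht j)
      (top_suffix g (X j) (hsc j) (t j) (ht j) (hmin j)) (hj i) (hE i j hij)
  have h3 : ∃ i k : Fin 3, i ≠ j ∧ k ≠ j ∧ i ≠ k := by
    clear key hj
    revert j
    decide
  obtain ⟨i, k, hi, hk, hik⟩ := h3
  obtain ⟨p, hp, c, hc⟩ := key i hi
  obtain ⟨q, hq, c2, hc2⟩ := key k hk
  have hpq : p = q := hg (List.cons.inj (hc.symm.trans hc2)).2
  subst hpq
  exact Set.disjoint_left.mp (hdis i k hik) hp hq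

theorem outDeg_ge {W : Type} [Finite W] {d : ℕ} (g : W → List (Fin d))
    (hs : ∀ l : List (Fin d), l.length ≤ d → ∃ w, g w = l) (hlen : ∀ w, (g w).length ≤ d)
    (v : W) : d ≤ outDeg (fun a b => TreeAdj d (g a) (g b)) v := by
  have main : ∀ F : Fin d → List (Fin d), Function.Injective F →
      (∀ i, (F i).length ≤ d ∧ TreeAdj d (g v) (F i)) →
      d ≤ outDeg (fun a b => TreeAdj d (g a) (g b)) v := by
    intro F hF h
    choose w hw using fun i => hs (F i) (h i).1
    have hwi : Function.Injective w := fun a b hab => hF (by rw [← hw a, ← hw b, hab])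
    have hsub : Set.range w ⊆ {x | TreeAdj d (g v) (g x)} := by
      rintro _ ⟨i, rfl⟩
      change TreeAdj d (g v) (g (w i))
      rw [hw]
      exact (h i).2
    have h1 := Set.ncard_le_ncard hsub (Set.toFinite _)
    rw [Set.ncard_range_of_injective hwi, Nat.card_fin] at h1
    exact h1
  by_cases hv : (g v).length = d
  · apply main (fun i => (g v).drop (i + 1))
    · intro a b hab
      have := congrArg List.length hab
      simp only [List.length_drop, hv] at this
      ext
      omega
    · intro i
      refine ⟨by simp only [List.length_drop]; omega, Or.inr ⟨hv, List.drop_suffix _ _, ?_⟩⟩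
      intro h
      have := congrArg List.length h
      simp only [List.length_drop, hv] at this
      omega
  · apply main (fun i => i :: g v)
    · intro a b hab
      exact (List.cons.inj hab).1
    · intro i
      refine ⟨?_, Or.inl ⟨i, rfl⟩⟩
      have := hlen v
      simp only [List.length_cons]
      omega

/-- for every `f : ℕ → ℕ` there are `r` and a digraph `D` with
minimum out-degree at least `f r` containing no strong `K⃗ r` minor. -/
theorem no_outdegree_function_forces_strong_minor (f : ℕ → ℕ) :
    ∃ (r n : ℕ) (Adj : Fin n → Fin n → Prop),
      0 < n ∧ Irreflexive Adj ∧
      (∀ v : Fin n, f r ≤ outDeg Adj v) ∧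
      ¬ ContainsStrongCompleteMinor Adj r := by
  set d := f 3 with hd
  let V := {l : List (Fin d) // l.length ≤ d}
  have : Finite V := (List.finite_length_le (Fin d) d).to_subtype
  obtain ⟨n, ⟨e⟩⟩ := Finite.exists_equiv_fin V
  let g : Fin n → List (Fin d) := fun w => (e.symm w).1
  have hg : Function.Injective g := Subtype.val_injective.comp e.symm.injective
  refine ⟨3, n, fun a b => TreeAdj d (g a) (g b), ?_, ?_, ?_, no_minor g hg⟩
  · exact Fin.pos (e ⟨[], Nat.zero_le _⟩)
  · intro v h
    rcases h with ⟨a, ha⟩ | h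
    · have := congrArg List.length ha
      simp at this
    · exact h.2.2 rfl
  · intro v
    exact outDeg_ge g (fun l hl => ⟨e ⟨l, hl⟩, by simp [g]⟩) (fun w => (e.symm w).2) v
end

section
/- Let r ≥ 1 be an integer. If D is a digraph with dichromatic number χ(D) ≥ r·4^r, then D contains a strong K⃗_r minor, i.e. sm(D) ≥ r. -/
namespace StrongMinor

open Relation

variable {V : Type}

/-- adjacency inside `S` -/
abbrev Ron (Adj : V → V → Prop) (S : Set V) : V → V → Prop :=
  fun a b => a ∈ S ∧ b ∈ S ∧ Adj a b

theorem ron_mono {Adj : V → V → Prop} {S T : Set V} (h : S ⊆ T) {a b : V}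
    (hab : ReflTransGen (Ron Adj S) a b) : ReflTransGen (Ron Adj T) a b :=
  ReflTransGen.mono (fun _ _ h' => ⟨h h'.1, h h'.2.1, h'.2.2⟩) _ _ hab

theorem ron_mono' {Adj : V → V → Prop} {S T : Set V} (h : S ⊆ T) {a b : V}
    (hab : TransGen (Ron Adj S) a b) : TransGen (Ron Adj T) a b :=
  TransGen.mono (fun _ _ h' => ⟨h h'.1, h h'.2.1, h'.2.2⟩) _ _ hab

theorem acyclic_mono {Adj : V → V → Prop} {S T : Set V} (h : S ⊆ T)
    (hT : AcyclicOn Adj T) : AcyclicOn Adj S :=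
  fun v hv hc => hT v (h hv) (ron_mono' h hc)

theorem color_mono {Adj : V → V → Prop} {S : Set V} {k l : ℕ} (h : k ≤ l)
    (hS : DiColorableOn Adj S k) : DiColorableOn Adj S l := by
  obtain ⟨c, h1, h2⟩ := hS
  exact ⟨c, fun v hv => (h1 v hv).trans_le h, h2⟩

/-- vertices of `T` between `a` and `b` -/
def Itv (Adj : V → V → Prop) (T : Set V) (a b : V) : Set V :=
  {z ∈ T | ReflTransGen (Ron Adj T) a z ∧ ReflTransGen (Ron Adj T) z b}

theorem itv_trans {Adj : V → V → Prop} {T : Set V} {a b : V}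
    (h : TransGen (Ron Adj T) a b) : TransGen (Ron Adj (Itv Adj T a b)) a b := by
  have key : ∀ c, TransGen (Ron Adj T) a c → ReflTransGen (Ron Adj T) c b →
      TransGen (Ron Adj (Itv Adj T a b)) a c := by
    intro c hc
    induction hc with
    | single hac =>
      intro hcb
      exact .single ⟨⟨hac.1, .refl, hcb.head hac⟩, ⟨hac.2.1, .single hac, hcb⟩, hac.2.2⟩
    | tail hac hcd ih =>
      intro hdb
      refine (ih (hdb.head hcd)).tail ⟨⟨hcd.1, hac.to_reflTransGen, hdb.head hcd⟩,
        ⟨hcd.2.1, hac.to_reflTransGen.tail hcd, hdb⟩, hcd.2.2⟩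
  exact key b h .refl

theorem itv_reach {Adj : V → V → Prop} {T : Set V} {a b : V}
    (h : ReflTransGen (Ron Adj T) a b) : ReflTransGen (Ron Adj (Itv Adj T a b)) a b := by
  rcases reflTransGen_iff_eq_or_transGen.1 h with rfl | h
  · exact .refl
  · exact (itv_trans h).to_reflTransGen

theorem itv_sub {Adj : V → V → Prop} {T : Set V} {a b c d : V}
    (h1 : ReflTransGen (Ron Adj T) a c) (h2 : ReflTransGen (Ron Adj T) d b) :
    Itv Adj T c d ⊆ Itv Adj T a b :=
  fun _ hz => ⟨hz.1, h1.trans hz.2.1, hz.2.2.trans h2⟩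

/-- strong component of `v` is strongly connected -/
theorem itv_strong {Adj : V → V → Prop} {T : Set V} {v : V} :
    StronglyConnectedOn Adj (Itv Adj T v v) := by
  intro a ha b hb
  have h := itv_reach (ha.2.2.trans hb.2.1)
  exact ron_mono (itv_sub ha.2.1 hb.2.2) h

def Petal (Adj : V → V → Prop) (R : Set V) : Prop :=
  ∃ x ∈ R, ∃ y ∈ R, ∀ z ∈ R, ReflTransGen (Ron Adj R) x z ∧ ReflTransGen (Ron Adj R) z y

theorem itv_petal {Adj : V → V → Prop} {T : Set V} {x y : V} (hx : x ∈ T) (hy : y ∈ T)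
    (h : ReflTransGen (Ron Adj T) x y) : Petal Adj (Itv Adj T x y) := by
  refine ⟨x, ⟨hx, .refl, h⟩, y, ⟨hy, h, .refl⟩, fun z hz => ⟨?_, ?_⟩⟩
  · exact ron_mono (itv_sub .refl hz.2.2) (itv_reach hz.2.1)
  · exact ron_mono (itv_sub hz.2.1 .refl) (itv_reach hz.2.2)

theorem exists_petal {Adj : V → V → Prop} (hD : Irreflexive Adj) {A : Set V} {v : V}
    (hv : v ∉ A) (hA : AcyclicOn Adj A) (hAv : ¬ AcyclicOn Adj (insert v A)) :
    ∃ R ⊆ A, Petal Adj R ∧ (∃ z ∈ R, Adj v z) ∧ (∃ z ∈ R, Adj z v) := by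
  by_contra hno
  have hno' : ∀ x ∈ A, ∀ y ∈ A, Adj v x → Adj y v → ¬ ReflTransGen (Ron Adj A) x y := by
    intro x hx y hy hvx hyv h
    exact hno ⟨Itv Adj A x y, fun z hz => hz.1, itv_petal hx hy h,
      ⟨x, ⟨hx, .refl, h⟩, hvx⟩, ⟨y, ⟨hy, h, .refl⟩, hyv⟩⟩
  apply hAv
  intro u hu hc
  have key : ∀ b, TransGen (Ron Adj (insert v A)) v b →
      b ∈ A ∧ ∃ x ∈ A, Adj v x ∧ ReflTransGen (Ron Adj A) x b := by
    intro b hb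
    induction hb with
    | single h =>
      rcases h.2.1 with rfl | hb
      · exact absurd h.2.2 (hD _)
      · exact ⟨hb, _, hb, h.2.2, .refl⟩
    | tail _ h ih =>
      obtain ⟨hb, x, hx, hvx, hxb⟩ := ih
      rcases h.2.1 with rfl | hc
      · exact absurd hxb (hno' x hx _ hb hvx h.2.2)
      · exact ⟨hc, x, hx, hvx, hxb.tail ⟨hb, hc, h.2.2⟩⟩
  have key2 : ∀ b, TransGen (Ron Adj (insert v A)) u b → TransGen (Ron Adj A) u b ∨
      (ReflTransGen (Ron Adj (insert v A)) u v ∧ ReflTransGen (Ron Adj (insert v A)) v b) := by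
    intro b hb
    induction hb with
    | single h =>
      rcases h.1 with h1 | h1
      · subst h1; exact .inr ⟨.refl, .single h⟩
      rcases h.2.1 with h2 | h2
      · subst h2; exact .inr ⟨.single h, .refl⟩
      exact .inl (.single ⟨h1, h2, h.2.2⟩)
    | tail hub h ih =>
      rcases ih with ih | ih
      · rcases h.1 with h1 | h1
        · subst h1; exact .inr ⟨hub.to_reflTransGen, .single h⟩
        rcases h.2.1 with h2 | h2
        · subst h2; exact .inr ⟨hub.to_reflTransGen.tail h, .refl⟩
        exact .inl (ih.tail ⟨h1, h2, h.2.2⟩)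
      · exact .inr ⟨ih.1, ih.2.tail h⟩
  rcases key2 u hc with h | h
  · obtain ⟨w, hw, -⟩ := TransGen.head'_iff.1 h
    exact hA u hw.1 h
  · exact hv (key v ((TransGen.trans_right h.2 hc).trans_left h.1)).1

/-- colouring by fibres of a layering -/
theorem color_layers {Adj : V → V → Prop} {C : Set V} {k : ℕ} (f : V → ℤ)
    (hf : ∀ a ∈ C, ∀ b ∈ C, Adj a b → f b ≤ f a + 1)
    (hk : ∀ i, DiColorableOn Adj {z ∈ C | f z = i} k) : DiColorableOn Adj C (2 * k) := by
  choose c hc1 hc2 using hk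
  refine ⟨fun v => 2 * c (f v) v + (f v % 2).toNat, ?_, ?_⟩
  · intro v hv
    have := hc1 (f v) v ⟨hv, rfl⟩
    show 2 * c (f v) v + (f v % 2).toNat < _
    omega
  · intro i u hu hcyc
    set T := {v ∈ C | 2 * c (f v) v + (f v % 2).toNat = i} with hT
    have step : ∀ a b, Ron Adj T a b → f b ≤ f a := by
      rintro a b ⟨⟨ha, ha'⟩, ⟨hb, hb'⟩, hab⟩
      have := hf a ha b hb hab
      omega
    have key : ∀ b, TransGen (Ron Adj T) u b → f b ≤ f u ∧ (f b = f u →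
        TransGen (Ron Adj {z ∈ T | f z = f u}) u b) := by
      intro b hb
      induction hb with
      | single h => exact ⟨step _ _ h, fun e => .single ⟨⟨h.1, rfl⟩, ⟨h.2.1, e⟩, h.2.2⟩⟩
      | tail _ h ih =>
        have := step _ _ h
        refine ⟨this.trans ih.1, fun e => ?_⟩
        have e' := le_antisymm ih.1 (e ▸ this)
        exact (ih.2 e').tail ⟨⟨h.1, e'⟩, ⟨h.2.1, e⟩, h.2.2⟩
    have h := (key u hcyc).2 rfl
    refine hc2 (f u) (c (f u) u) u ⟨⟨hu.1, rfl⟩, rfl⟩ (ron_mono' ?_ h)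
    rintro z ⟨⟨hz, hz'⟩, hzf⟩
    refine ⟨⟨hz, hzf⟩, ?_⟩
    have := hu.2
    rw [hzf] at hz'
    omega

/-- colouring a set from its strong component at `v` and the rest -/
theorem color_comp {Adj : V → V → Prop} {T : Set V} {v : V} {k : ℕ}
    (h1 : DiColorableOn Adj (Itv Adj T v v) k) (h2 : DiColorableOn Adj (T \ {v}) k)
    (hv : v ∈ T) : DiColorableOn Adj T k := by
  classical
  obtain ⟨c1, a1, b1⟩ := h1
  obtain ⟨c2, a2, b2⟩ := h2
  have hvv : v ∈ Itv Adj T v v := ⟨hv, .refl, .refl⟩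
  refine ⟨fun z => if z ∈ Itv Adj T v v then c1 z else c2 z, ?_, ?_⟩
  · intro z hz
    by_cases h : z ∈ Itv Adj T v v
    · simpa [h] using a1 z h
    · simpa [h] using a2 z ⟨hz, fun e => h (by rw [e]; exact hvv)⟩
  · intro i u hu hc
    have hs : {z ∈ T | (if z ∈ Itv Adj T v v then c1 z else c2 z) = i} ⊆ T := fun z hz => hz.1
    have h := itv_trans hc
    by_cases hC : u ∈ Itv Adj T v v
    · refine b1 i u ⟨hC, by simpa [hC] using hu.2⟩ (ron_mono' ?_ h)
      rintro z ⟨hz, hz1, hz2⟩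
      have hzC : z ∈ Itv Adj T v v :=
        ⟨hz.1, hC.2.1.trans (ron_mono hs hz1), (ron_mono hs hz2).trans hC.2.2⟩
      exact ⟨hzC, by simpa [hzC] using hz.2⟩
    · have aux : ∀ z, z ∉ Itv Adj T v v → z ∈ T → z ∈ T \ {v} :=
        fun z hz hzT => ⟨hzT, fun e => hz (by rw [e]; exact hvv)⟩
      refine b2 i u ⟨aux u hC hu.1, by simpa [hC] using hu.2⟩ (ron_mono' ?_ h)
      rintro z ⟨hz, hz1, hz2⟩
      have hzC : z ∉ Itv Adj T v v := fun hzC => hC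
        ⟨hu.1, hzC.2.1.trans (ron_mono hs hz2), (ron_mono hs hz1).trans hzC.2.2⟩
      exact ⟨aux z hzC hz.1, by simpa [hzC] using hz.2⟩

/-- balls -/
def ball (Adj : V → V → Prop) (C : Set V) (v : V) : ℕ → Set V
  | 0 => {v}
  | n + 1 => ball Adj C v n ∪ {b ∈ C | ∃ a ∈ ball Adj C v n, a ∈ C ∧ Adj a b}

theorem exists_dist {Adj : V → V → Prop} {C : Set V} {v : V}
    (hr : ∀ u ∈ C, ReflTransGen (Ron Adj C) v u) :
    ∃ d : V → ℕ, (∀ u ∈ C, d u = d v → u = v) ∧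
      (∀ a ∈ C, ∀ b ∈ C, Adj a b → d b ≤ d a + 1) ∧
      (∀ u ∈ C, ReflTransGen (Ron Adj {z ∈ C | d z < d u ∨ z = u}) v u) := by
  classical
  have hex : ∀ u ∈ C, ∃ n, u ∈ ball Adj C v n := by
    intro u hu
    have := hr u hu
    clear hu
    induction this with
    | refl => exact ⟨0, rfl⟩
    | tail _ h ih =>
      obtain ⟨n, hn⟩ := ih
      exact ⟨n + 1, .inr ⟨h.2.1, _, hn, h.1, h.2.2⟩⟩
  let d : V → ℕ := fun u => sInf {n | u ∈ ball Adj C v n}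
  have hmem : ∀ u ∈ C, u ∈ ball Adj C v (d u) := fun u hu => Nat.sInf_mem (hex u hu)
  have hle : ∀ u n, u ∈ ball Adj C v n → d u ≤ n := fun u n h => Nat.sInf_le h
  have hdv : d v = 0 := Nat.le_zero.1 (hle v 0 rfl)
  have h0 : ∀ u ∈ C, d u = 0 → u = v := by
    intro u hu h
    have := hmem u hu
    rw [h] at this
    exact this
  have hpred : ∀ u ∈ C, u ≠ v → ∃ p ∈ C, d p < d u ∧ Adj p u := by
    intro u hu huv
    have h := hmem u hu
    rcases hd : d u with _ | n
    · exact absurd (h0 u hu hd) huv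
    rw [hd] at h
    rcases h with h | ⟨_, a, ha, haC, hau⟩
    · have := hle u n h
      omega
    · exact ⟨a, haC, Nat.lt_succ_of_le (hle a n ha), hau⟩
  refine ⟨d, fun u hu h => h0 u hu (h.trans hdv), ?_, ?_⟩
  · intro a ha b hb hab
    exact hle b _ (.inr ⟨hb, a, hmem a ha, ha, hab⟩)
  · have : ∀ n, ∀ u ∈ C, d u = n →
        ReflTransGen (Ron Adj {z ∈ C | d z < d u ∨ z = u}) v u := by
      intro n
      induction n using Nat.strong_induction_on with
      | _ n ih =>
        intro u hu hd
        by_cases huv : u = v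
        · subst huv; exact .refl
        obtain ⟨p, hp, hlt, hpu⟩ := hpred u hu huv
        refine (ron_mono ?_ (ih (d p) (hd ▸ hlt) p hp rfl)).tail
          ⟨⟨hp, .inl hlt⟩, ⟨hu, .inr rfl⟩, hpu⟩
        rintro z ⟨hz, h | rfl⟩
        · exact ⟨hz, .inl (h.trans hlt)⟩
        · exact ⟨hz, .inl hlt⟩
    exact fun u hu => this _ u hu rfl

/-- the main layering lemma -/
theorem exists_W {Adj : V → V → Prop} (hD : Irreflexive Adj) {C : Set V} {v : V} {q : ℕ}
    (hv : v ∈ C) (hS : StronglyConnectedOn Adj C) (hq : 1 ≤ q)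
    (hC : ¬ DiColorableOn Adj C (4 * q)) :
    ∃ W ⊆ C, v ∉ W ∧ ¬ DiColorableOn Adj W q ∧
      ∀ w ∈ W, ReflTransGen (Ron Adj (insert w (C \ W))) v w ∧
        ReflTransGen (Ron Adj (insert w (C \ W))) w v := by
  obtain ⟨d, d1, d2, d3⟩ := exists_dist (fun u hu => hS hv hu)
  obtain ⟨e, e1, e2, e3⟩ := exists_dist (Adj := fun a b => Adj b a) (C := C) (v := v) (by
    intro u hu
    refine ReflTransGen.mono ?_ _ _ (hS hu hv).swap
    rintro a b ⟨h1, h2, h3⟩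
    exact ⟨h2, h1, h3⟩)
  have : ∃ i j : ℤ, ¬ DiColorableOn Adj {z ∈ {z ∈ C | (d z : ℤ) = i} | -(e z : ℤ) = j} q := by
    by_contra! hno
    apply hC
    have : 4 * q = 2 * (2 * q) := by ring
    rw [this]
    refine color_layers (fun z => (d z : ℤ)) ?_ (fun i => color_layers (fun z => -(e z : ℤ)) ?_ (hno i))
    · intro a ha b hb hab
      have := d2 a ha b hb hab
      omega
    · intro a ha b hb hab
      have := e2 b hb.1 a ha.1 hab
      omega
  obtain ⟨i, j, hW⟩ := this
  set W := {z ∈ {z ∈ C | (d z : ℤ) = i} | -(e z : ℤ) = j} with hWdef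
  refine ⟨W, fun z hz => hz.1.1, ?_, hW, ?_⟩
  · intro hvW
    apply hW
    have hone : ∀ z ∈ W, z = v := by
      intro z hz
      refine d1 z hz.1.1 ?_
      have h1 := hz.1.2
      have h2 := hvW.1.2
      omega
    refine ⟨fun _ => 0, fun _ _ => hq, ?_⟩
    intro k u hu hc
    obtain ⟨w, hw, -⟩ := TransGen.head'_iff.1 hc
    have h1 := hone _ hw.1.1
    have h2 := hone _ hw.2.1.1
    have h3 := hw.2.2
    rw [h1, h2] at h3
    exact hD _ h3
  · intro w hw
    constructor
    · refine ron_mono ?_ (d3 w hw.1.1)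
      rintro z ⟨hz, h | rfl⟩
      · refine .inr ⟨hz, fun hzW => ?_⟩
        have h1 := hzW.1.2
        have h2 := hw.1.2
        omega
      · exact .inl rfl
    · refine ReflTransGen.mono ?_ _ _ (e3 w hw.1.1).swap
      have hsub : {z ∈ C | e z < e w ∨ z = w} ⊆ insert w (C \ W) := by
        rintro z ⟨hz, h | rfl⟩
        · refine .inr ⟨hz, fun hzW => ?_⟩
          have h1 := hzW.2
          have h2 := hw.2
          omega
        · exact .inl rfl
      rintro a b ⟨h1, h2, h3⟩
      exact ⟨hsub h2, hsub h1, h3⟩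

/-- critical vertex with petals -/
theorem exists_core [Finite V] {Adj : V → V → Prop} (hD : Irreflexive Adj) {S : Set V} {m s : ℕ}
    (hS : ¬ DiColorableOn Adj S m) (hs : s ≤ m) :
    ∃ v, ∃ C ⊆ S, ∃ R : Fin s → Set V, v ∈ C ∧ StronglyConnectedOn Adj C ∧
      ¬ DiColorableOn Adj C (m - s) ∧
      (∀ j, R j ⊆ S ∧ Disjoint C (R j) ∧ Petal Adj (R j) ∧ (∃ z ∈ R j, Adj v z) ∧
        (∃ z ∈ R j, Adj z v)) ∧
      (∀ i j, i ≠ j → Disjoint (R i) (R j)) := by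
  classical
  obtain ⟨H, hHS, hH⟩ := (Set.toFinite {T : Set V | ¬ DiColorableOn Adj T m}).exists_le_minimal hS
  have hne : H.Nonempty := by
    by_contra h
    rw [Set.not_nonempty_iff_eq_empty] at h
    apply hH.1
    rw [h]
    exact ⟨fun _ => 0, fun _ h => h.elim, fun i v hv => hv.1.elim⟩
  obtain ⟨v, hv⟩ := hne
  have hcol : DiColorableOn Adj (H \ {v}) m := by
    by_contra h
    exact (hH.2 h (fun z hz => hz.1) hv).2 rfl
  obtain ⟨c, c1, c2⟩ := hcol
  let A : ℕ → Set V := fun i => {z ∈ H \ {v} | c z = i}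
  have hpet : ∀ j : Fin s, ∃ R ⊆ A j, Petal Adj R ∧ (∃ z ∈ R, Adj v z) ∧ (∃ z ∈ R, Adj z v) := by
    intro j
    refine exists_petal hD (fun h => h.1.2 rfl) (c2 j) fun hac => hH.1 ?_
    refine ⟨Function.update c v j, ?_, ?_⟩
    · intro z hz
      by_cases h : z = v
      · subst h; simpa using j.2.trans_le hs
      · simpa [h] using c1 z ⟨hz, h⟩
    · intro i
      by_cases hij : i = j
      · subst hij
        refine acyclic_mono ?_ hac
        rintro z ⟨hz, hz'⟩
        by_cases h : z = v
        · exact .inl h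
        · exact .inr ⟨⟨hz, h⟩, by simpa [h] using hz'⟩
      · refine acyclic_mono ?_ (c2 i)
        rintro z ⟨hz, hz'⟩
        by_cases h : z = v
        · subst h
          simp at hz'
          exact absurd hz'.symm hij
        · exact ⟨⟨hz, h⟩, by simpa [h] using hz'⟩
  choose R r1 r2 r3 r4 using hpet
  let H' : Set V := {z ∈ H | z = v ∨ s ≤ c z}
  have hvH' : v ∈ H' := ⟨hv, .inl rfl⟩
  refine ⟨v, Itv Adj H' v v, fun z hz => hHS hz.1.1, R, ⟨hvH', .refl, .refl⟩, itv_strong,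
    ?_, ?_, ?_⟩
  · intro hC
    have h2 : DiColorableOn Adj (H' \ {v}) (m - s) := by
      refine ⟨fun z => c z - s, ?_, ?_⟩
      · rintro z ⟨⟨hz, h⟩, hzv⟩
        have := c1 z ⟨hz, hzv⟩
        have h' : s ≤ c z := h.resolve_left hzv
        simp only; omega
      · intro i
        refine acyclic_mono ?_ (c2 (i + s))
        rintro z ⟨⟨⟨hz, h⟩, hzv⟩, h3⟩
        have h' : s ≤ c z := h.resolve_left hzv
        simp only at h3
        exact ⟨⟨hz, hzv⟩, by omega⟩
    obtain ⟨g, g1, g2⟩ := color_comp hC h2 hvH'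
    apply hH.1
    refine ⟨fun z => if z ∈ H' then s + g z else c z, ?_, ?_⟩
    · intro z hz
      by_cases h : z ∈ H'
      · have := g1 z h
        simp only [h, if_true]; omega
      · have : z ≠ v := fun e => h (e ▸ hvH')
        simpa [h] using c1 z ⟨hz, this⟩
    · intro i
      by_cases hi : i < s
      · refine acyclic_mono ?_ (c2 i)
        rintro z ⟨hz, h3⟩
        by_cases h : z ∈ H'
        · simp only [h, if_true] at h3; omega
        · have : z ≠ v := fun e => h (e ▸ hvH')
          exact ⟨⟨hz, this⟩, by simpa [h] using h3⟩
      · refine acyclic_mono ?_ (g2 (i - s))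
        rintro z ⟨hz, h3⟩
        by_cases h : z ∈ H'
        · simp only [h, if_true] at h3
          exact ⟨h, by omega⟩
        · simp only [h, if_false] at h3
          exact absurd ⟨hz, .inr (by omega)⟩ h
  · intro j
    refine ⟨fun z hz => hHS (r1 j hz).1.1, ?_, r2 j, r3 j, r4 j⟩
    rw [Set.disjoint_left]
    intro z hz hzR
    have h1 := r1 j hzR
    have h2 := hz.1.2.resolve_left h1.1.2
    have h3 : c z = j := h1.2
    have := j.2
    omega
  · intro i j hij
    rw [Set.disjoint_left]
    intro z hz hz'
    have h1 : c z = i := (r1 i hz).2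
    have h2 : c z = j := (r1 j hz').2
    exact hij (Fin.ext (h1.symm.trans h2))

/-- a strong complete minor with petals -/
def PM (Adj : V → V → Prop) (n s : ℕ) (S : Set V) : Prop :=
  ∃ X : Fin n → Set V, ∃ R : Fin n → Fin s → Set V,
    (∀ i, X i ⊆ S ∧ (X i).Nonempty ∧ StronglyConnectedOn Adj (X i)) ∧
    (∀ i j, i ≠ j → Disjoint (X i) (X j)) ∧
    (∀ i j, i ≠ j → ∃ u ∈ X i, ∃ v ∈ X j, Adj u v) ∧
    (∀ i j, R i j ⊆ S ∧ Petal Adj (R i j) ∧ (∃ u ∈ X i, ∃ z ∈ R i j, Adj u z) ∧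
      (∃ u ∈ X i, ∃ z ∈ R i j, Adj z u)) ∧
    (∀ i k j, Disjoint (X i) (R k j)) ∧
    (∀ i j i' j', (i ≠ i' ∨ j ≠ j') → Disjoint (R i j) (R i' j'))

theorem pm_step {Adj : V → V → Prop} {n s : ℕ} {S C W : Set V} {v : V}
    {P : Fin s → Set V} (hCS : C ⊆ S) (hv : v ∈ C)
    (hP : ∀ j, P j ⊆ S ∧ Disjoint C (P j) ∧ Petal Adj (P j) ∧ (∃ z ∈ P j, Adj v z) ∧
        (∃ z ∈ P j, Adj z v))
    (hPd : ∀ i j, i ≠ j → Disjoint (P i) (P j))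
    (hWC : W ⊆ C) (hvW : v ∉ W)
    (hW : ∀ w ∈ W, ReflTransGen (Ron Adj (insert w (C \ W))) v w ∧
        ReflTransGen (Ron Adj (insert w (C \ W))) w v)
    (hpm : PM Adj n (s + 1) W) : PM Adj (n + 1) s S := by
  obtain ⟨X, R, h1, h2, h3, h4, h5, h6⟩ := hpm
  set U : Set V := (C \ W) ∪ ⋃ k, R k (Fin.last s) with hU
  set X0 : Set V := Itv Adj U v v with hX0
  have hUC : U ⊆ C := by
    rintro z (hz | hz)
    · exact hz.1
    · obtain ⟨k, hk⟩ := Set.mem_iUnion.1 hz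
      exact hWC ((h4 k _).1 hk)
  have hvU : v ∈ U := .inl ⟨hv, hvW⟩
  have hvX : v ∈ X0 := ⟨hvU, .refl, .refl⟩
  have hX0C : X0 ⊆ C := fun z hz => hUC hz.1
  have hR0 : ∀ k, R k (Fin.last s) ⊆ X0 := by
    intro k z hz
    have hRU : R k (Fin.last s) ⊆ U := fun z hz => .inr (Set.mem_iUnion.2 ⟨k, hz⟩)
    have hins : ∀ x ∈ R k (Fin.last s), insert x (C \ W) ⊆ U := by
      rintro x hx y (rfl | hy)
      · exact hRU hx
      · exact .inl hy
    obtain ⟨hRW, ⟨x, hx, y, hy, hxy⟩, -, -⟩ := h4 k (Fin.last s)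
    refine ⟨hRU hz, ?_, ?_⟩
    · exact (ron_mono (hins x hx) (hW x (hRW hx)).1).trans (ron_mono hRU (hxy z hz).1)
    · exact (ron_mono hRU (hxy z hz).2).trans (ron_mono (hins y hy) (hW y (hRW hy)).2)
  have hX0W : ∀ T ⊆ W, (∀ k, Disjoint T (R k (Fin.last s))) → Disjoint X0 T := by
    intro T hT hTd
    rw [Set.disjoint_left]
    intro z hz hzT
    rcases hz.1 with h | h
    · exact h.2 (hT hzT)
    · obtain ⟨k, hk⟩ := Set.mem_iUnion.1 h
      exact Set.disjoint_left.1 (hTd k) hzT hk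
  have hX0X : ∀ i, Disjoint X0 (X i) := fun i => hX0W _ (h1 i).1 (fun k => h5 i k _)
  have hX0R : ∀ i (j : Fin s), Disjoint X0 (R i j.castSucc) := fun i j =>
    hX0W _ (h4 i _).1 (fun k => h6 _ _ _ _ (.inr (Fin.castSucc_lt_last j).ne))
  have hWS := hWC.trans hCS
  refine ⟨Fin.cons X0 X, Fin.cons P (fun k j => R k j.castSucc), ?_, ?_, ?_, ?_, ?_, ?_⟩
  · refine Fin.cases ?_ ?_
    · exact ⟨hX0C.trans hCS, ⟨v, hvX⟩, itv_strong⟩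
    · intro i
      exact ⟨(h1 i).1.trans hWS, (h1 i).2⟩
  · refine Fin.cases ?_ ?_
    · refine Fin.cases (fun h => (h rfl).elim) ?_
      intro i _
      exact hX0X i
    · intro i
      refine Fin.cases (fun _ => (hX0X i).symm) ?_
      intro j hij
      exact h2 i j (fun e => hij (e ▸ rfl))
  · refine Fin.cases ?_ ?_
    · refine Fin.cases (fun h => (h rfl).elim) ?_
      intro i _
      obtain ⟨u, hu, z, hz, huz⟩ := (h4 i (Fin.last s)).2.2.2
      exact ⟨z, hR0 i hz, u, hu, huz⟩
    · intro i
      refine Fin.cases ?_ ?_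
      · intro _
        obtain ⟨u, hu, z, hz, huz⟩ := (h4 i (Fin.last s)).2.2.1
        exact ⟨u, hu, z, hR0 i hz, huz⟩
      intro j hij
      exact h3 i j (fun e => hij (e ▸ rfl))
  · refine Fin.cases ?_ ?_
    · intro j
      obtain ⟨a, _, b, c, d⟩ := hP j
      exact ⟨a, b, ⟨v, hvX, c⟩, ⟨v, hvX, d⟩⟩
    · intro i j
      exact ⟨(h4 i _).1.trans hWS, (h4 i _).2⟩
  · refine Fin.cases ?_ ?_
    · refine Fin.cases ?_ ?_
      · intro j
        exact (hP j).2.1.mono_left hX0C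
      · intro i j
        exact hX0R i j
    · intro i
      refine Fin.cases ?_ ?_
      · intro j
        exact (hP j).2.1.mono_left ((h1 i).1.trans hWC)
      · intro k j
        exact h5 i k _
  · refine Fin.cases ?_ ?_
    · intro j
      refine Fin.cases ?_ ?_
      · intro j' h
        exact hPd j j' (h.resolve_left (fun h => h rfl))
      · intro i j' _
        exact ((hP j).2.1.mono_left ((h4 i _).1.trans hWC)).symm
    · intro i j
      refine Fin.cases ?_ ?_
      · intro j' _
        exact (hP j').2.1.mono_left ((h4 i _).1.trans hWC)
      · intro i' j' h
        refine h6 _ _ _ _ (h.imp (fun h e => h (congrArg Fin.succ e)) (fun h e => h ?_))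
        exact Fin.castSucc_injective _ e

theorem pm_main [Finite V] {Adj : V → V → Prop} (hD : Irreflexive Adj) (n : ℕ) :
    ∀ (s m : ℕ) (S : Set V), m + s + 1 = (n + s) * 4 ^ n → ¬ DiColorableOn Adj S m →
      PM Adj n s S := by
  induction n with
  | zero =>
    intro s m S _ _
    exact ⟨fun i => i.elim0, fun i => i.elim0, fun i => i.elim0, fun i => i.elim0,
      fun i => i.elim0, fun i => i.elim0, fun i => i.elim0, fun i => i.elim0⟩
  | succ n ih =>
    intro s m S hm hS
    have hpos : 1 ≤ 4 ^ n := Nat.one_le_pow _ _ (by norm_num)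
    have hm' : m + s + 1 = 4 * ((n + (s + 1)) * 4 ^ n) := by rw [hm, pow_succ]; ring
    have hge : n + (s + 1) ≤ (n + (s + 1)) * 4 ^ n := Nat.le_mul_of_pos_right _ hpos
    obtain ⟨v, C, hCS, P, hv, hC, hcol, hP, hPd⟩ := exists_core hD (s := s) hS (by omega)
    rcases Nat.eq_zero_or_pos n with rfl | hn
    · refine pm_step hCS hv hP hPd (Set.empty_subset C) (Set.notMem_empty v)
        (fun w hw => hw.elim) ?_
      exact ⟨fun i => i.elim0, fun i => i.elim0, fun i => i.elim0, fun i => i.elim0,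
        fun i => i.elim0, fun i => i.elim0, fun i => i.elim0, fun i => i.elim0⟩
    · have h4 : 4 * (n + (s + 1)) ≤ (n + (s + 1)) * 4 ^ n := by
        rw [mul_comm]
        exact Nat.mul_le_mul_left _ (by simpa using Nat.pow_le_pow_right (n := 4) (by norm_num) hn)
      set K := (n + (s + 1)) * 4 ^ n with hK
      obtain ⟨W, hWC, hvW, hWcol, hW⟩ := exists_W hD (q := K - (s + 2)) hv hC (by omega)
        (fun h => hcol (color_mono (by omega) h))
      exact pm_step hCS hv hP hPd hWC hvW hW (ih (s + 1) _ W (by omega) hWcol)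

end StrongMinor

/-- every digraph with dichromatic number at least `r * 4 ^ r`
(`r ≥ 1`) contains a strong `K⃗ r` minor. -/
theorem digraph_chi_ge_r_four_pow_r_strong_minor
    {V : Type} [Fintype V] (Adj : V → V → Prop) (hD : Irreflexive Adj)
    (r : ℕ) (hr : 1 ≤ r)
    (hchi : r * 4 ^ r ≤ dichromaticNumberOn Adj Set.univ) :
    ContainsStrongCompleteMinor Adj r := by
  have hpos : 1 ≤ r * 4 ^ r := Nat.mul_pos hr (by positivity)
  obtain ⟨X, R, h1, h2, h3, -⟩ := StrongMinor.pm_main hD r 0 (r * 4 ^ r - 1) Set.univ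
    (by simp only [add_zero]; omega) (fun h => by
      have : dichromaticNumberOn Adj Set.univ ≤ r * 4 ^ r - 1 := Nat.sInf_le h
      omega)
  exact ⟨X, fun i => (h1 i).2.1, h2, fun i => (h1 i).2.2, h3⟩
end
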